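/- (part of Theorem 1.2: pseudoconvexity is preserved) Under the stated hypotheses, let p ∈ M, let W be an open neighborhood of p in ℂ², and let F : W → ℂ² be holomorphic with F(z) = f(z) for all z ∈ W ∩ D. If there is a relative neighborhood N of p in M such that every point of N is a pseudoconvex point of ∂D, then F(p) ∈ M' and there is a relative neighborhood N' of F(p) in M' such that every point of N' is a pseudoconvex point of ∂D'. -/

import Mathlib

noncomputable section

open Complex Filter Metric Set

/-- `ℂ²`. -/
abbrev C2 := ℂ × ℂ

/-- Wirtinger derivative `∂g/∂z₁`. -/
def wd1 (g : C2 → ℂ) (p : C2) : ℂ :=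
  (1 / 2 : ℂ) * (fderiv ℝ g p ((1 : ℂ), (0 : ℂ)) - Complex.I * fderiv ℝ g p (Complex.I, (0 : ℂ)))

/-- Wirtinger derivative `∂g/∂z₂`. -/
def wd2 (g : C2 → ℂ) (p : C2) : ℂ :=
  (1 / 2 : ℂ) * (fderiv ℝ g p ((0 : ℂ), (1 : ℂ)) - Complex.I * fderiv ℝ g p ((0 : ℂ), Complex.I))

/-- Wirtinger derivative `∂g/∂z̄₁`. -/
def wdbar1 (g : C2 → ℂ) (p : C2) : ℂ :=
  (1 / 2 : ℂ) * (fderiv ℝ g p ((1 : ℂ), (0 : ℂ)) + Complex.I * fderiv ℝ g p (Complex.I, (0 : ℂ)))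

/-- Wirtinger derivative `∂g/∂z̄₂`. -/
def wdbar2 (g : C2 → ℂ) (p : C2) : ℂ :=
  (1 / 2 : ℂ) * (fderiv ℝ g p ((0 : ℂ), (1 : ℂ)) + Complex.I * fderiv ℝ g p ((0 : ℂ), Complex.I))

/-- Complexification of a real-valued function. -/
def oc (ρ : C2 → ℝ) : C2 → ℂ := fun p => ((ρ p : ℝ) : ℂ)

/-- Levi form `L_ρ(p)(t) = Σ_{j,k} ∂²ρ/∂z_j∂z̄_k (p) · t_j · conj t_k`. -/
def levi (ρ : C2 → ℝ) (p t : C2) : ℂ :=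
  wd1 (wdbar1 (oc ρ)) p * t.1 * (starRingEnd ℂ) t.1 +
  wd1 (wdbar2 (oc ρ)) p * t.1 * (starRingEnd ℂ) t.2 +
  wd2 (wdbar1 (oc ρ)) p * t.2 * (starRingEnd ℂ) t.1 +
  wd2 (wdbar2 (oc ρ)) p * t.2 * (starRingEnd ℂ) t.2

/-- `t` lies in the complex tangent space at `p` of the level set `{ρ = 0}`:
`∂ρ/∂z₁(p) t₁ + ∂ρ/∂z₂(p) t₂ = 0`. -/
def tangentVec (ρ : C2 → ℝ) (p t : C2) : Prop :=
  wd1 (oc ρ) p * t.1 + wd2 (oc ρ) p * t.2 = 0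

/-- Strong pseudoconvexity at `p` w.r.t. the defining function `ρ`:
the Levi form is positive on all nonzero complex tangent vectors. -/
def StronglyPseudoconvexAt (ρ : C2 → ℝ) (p : C2) : Prop :=
  ∀ t : C2, tangentVec ρ p t → t ≠ 0 → 0 < (levi ρ p t).re

/-- Pseudoconvexity at `p` w.r.t. the defining function `ρ`:
the Levi form is nonnegative on complex tangent vectors. -/
def PseudoconvexAt (ρ : C2 → ℝ) (p : C2) : Prop :=
  ∀ t : C2, tangentVec ρ p t → 0 ≤ (levi ρ p t).re

/-- Levi degeneracy at `p` w.r.t. the defining function `ρ`: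
the Levi form vanishes identically on the complex tangent space. -/
def LeviDegenerateAt (ρ : C2 → ℝ) (p : C2) : Prop :=
  ∀ t : C2, tangentVec ρ p t → levi ρ p t = 0

set_option linter.unusedSectionVars false

section hol
variable {E : Type*} [NormedAddCommGroup E] [NormedSpace ℂ E] [FiniteDimensional ℂ E]
  {G : Type*} [NormedAddCommGroup G] [NormedSpace ℂ G] [CompleteSpace G]

/-- restriction to a complex line is differentiable -/
lemma line_diff {U : Set E} (hU : IsOpen U) {f : E → G} (hf : DifferentiableOn ℂ f U)
    (z v : E) : DifferentiableOn ℂ (fun ζ : ℂ => f (z + ζ • v)) {ζ | z + ζ • v ∈ U} := by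
  intro ζ hζ
  have h1 : DifferentiableAt ℂ f (z + ζ • v) := hf.differentiableAt (hU.mem_nhds hζ)
  have h2 : DifferentiableAt ℂ (fun ζ : ℂ => z + ζ • v) ζ := by fun_prop
  exact (DifferentiableAt.comp ζ h1 h2).differentiableWithinAt

lemma line_deriv {f : E → G} {z v : E} {ζ : ℂ} (hf : DifferentiableAt ℂ f (z + ζ • v)) :
    HasDerivAt (fun ζ : ℂ => f (z + ζ • v)) (fderiv ℂ f (z + ζ • v) v) ζ := by
  have h2 : HasDerivAt (fun ζ : ℂ => z + ζ • v) v ζ := by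
    simpa using ((hasDerivAt_id ζ).smul_const v).const_add z
  exact hf.hasFDerivAt.comp_hasDerivAt ζ h2

lemma exists_small (z0 v : E) {U : Set E} (hU : IsOpen U) (hz : z0 ∈ U) :
    ∃ ε > 0, ∃ R > (0 : ℝ), closedBall z0 (2 * ε) ⊆ U ∧
      ∀ z ∈ closedBall z0 ε, ∀ ζ : ℂ, ‖ζ‖ ≤ R → z + ζ • v ∈ closedBall z0 (2 * ε) := by
  obtain ⟨δ, hδ, hb⟩ := Metric.nhds_basis_closedBall.mem_iff.1 (hU.mem_nhds hz)
  refine ⟨δ / 2, by positivity, (δ / 2) / (‖v‖ + 1), by positivity, ?_, ?_⟩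
  · rwa [mul_div_cancel₀ _ (two_ne_zero)]
  · intro z hz ζ hζ
    rw [mem_closedBall, dist_eq_norm] at *
    have h1 : ‖ζ • v‖ ≤ δ / 2 := by
      rw [norm_smul]
      have := (le_div_iff₀ (by positivity)).1 hζ
      nlinarith [norm_nonneg ζ, norm_nonneg v]
    calc ‖z + ζ • v - z0‖ = ‖(z - z0) + ζ • v‖ := by congr 1; abel
      _ ≤ ‖z - z0‖ + ‖ζ • v‖ := norm_add_le _ _
      _ ≤ _ := by linarith

lemma fderiv_dir_continuousOn {U : Set E} (hU : IsOpen U) {f : E → G}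
    (hf : DifferentiableOn ℂ f U) (v : E) : ContinuousOn (fun z => fderiv ℂ f z v) U := by
  intro z0 hz0
  apply ContinuousAt.continuousWithinAt
  obtain ⟨ε, hε, R, hR, hsub, hin⟩ := exists_small z0 v hU hz0
  have : ProperSpace E := FiniteDimensional.proper ℂ E
  have huc : UniformContinuousOn f (closedBall z0 (2 * ε)) :=
    (isCompact_closedBall _ _).uniformContinuousOn_of_continuous (hf.continuousOn.mono hsub)
  have htu : TendstoUniformlyOn (fun z (ζ : ℂ) => f (z + ζ • v)) (fun ζ => f (z0 + ζ • v))
      (nhds z0) (ball 0 R) := by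
    rw [Metric.tendstoUniformlyOn_iff]
    intro η hη
    obtain ⟨δ, hδ, hd⟩ := Metric.uniformContinuousOn_iff.1 huc η hη
    filter_upwards [ball_mem_nhds z0 hδ, closedBall_mem_nhds z0 hε] with z hz hz' ζ hζ
    have hζ' : ‖ζ‖ ≤ R := by simpa using (mem_ball_zero_iff.1 hζ).le
    refine hd _ (hin z0 (mem_closedBall_self hε.le) ζ hζ') _ (hin z hz' ζ hζ') ?_
    rw [dist_comm]; simpa using hz
  have hdv := htu.tendstoLocallyUniformlyOn.deriv (by
    filter_upwards [closedBall_mem_nhds z0 hε] with z hz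
    refine (line_diff hU hf z v).mono ?_
    intro ζ hζ
    exact hsub (hin z hz ζ (by simpa using (mem_ball_zero_iff.1 hζ).le))) isOpen_ball
  have h0 := hdv.tendsto_at (mem_ball_self hR)
  have key : ∀ z ∈ closedBall z0 ε, deriv (fun ζ : ℂ => f (z + ζ • v)) 0 = fderiv ℂ f z v := by
    intro z hz
    have hzU : z ∈ U := by
      have := hsub (hin z hz 0 (by simpa using hR.le))
      simpa using this
    have := (line_deriv (f := f) (z := z) (v := v) (ζ := 0)
      (by simpa using hf.differentiableAt (hU.mem_nhds hzU))).deriv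
    simpa using this
  unfold ContinuousAt
  rw [key z0 (mem_closedBall_self hε.le)] at h0
  refine h0.congr' ?_
  filter_upwards [closedBall_mem_nhds z0 hε] with z hz
  exact key z hz

lemma fderiv_continuousOn_of_hol {U : Set E} (hU : IsOpen U) {f : E → G}
    (hf : DifferentiableOn ℂ f U) : ContinuousOn (fderiv ℂ f) U :=
  continuousOn_clm_apply.2 fun v => fderiv_dir_continuousOn hU hf v

lemma fderiv_dir_hol {U : Set E} (hU : IsOpen U) {f : E → G}
    (hf : DifferentiableOn ℂ f U) (v : E) : DifferentiableOn ℂ (fun z => fderiv ℂ f z v) U := by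
  intro z0 hz0
  apply DifferentiableAt.differentiableWithinAt
  obtain ⟨ε, hε, R, hR, hsub, hin⟩ := exists_small z0 v hU hz0
  have : ProperSpace E := FiniteDimensional.proper ℂ E
  have hfc := fderiv_continuousOn_of_hol hU hf
  obtain ⟨C, hC⟩ := (isCompact_closedBall z0 (2 * ε)).exists_bound_of_continuousOn (hfc.mono hsub)
  -- the integral representation
  set c : ℝ → ℂ := fun θ => (2 * Real.pi * I : ℂ)⁻¹ * (deriv (circleMap 0 R) θ *
    ((circleMap 0 R θ) ^ 2)⁻¹) with hc
  have hcm : Continuous c := by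
    have : ∀ θ, circleMap 0 R θ ^ 2 ≠ 0 := fun θ => by
      simp [circleMap, hR.ne']
    have h1 : Continuous (fun θ => deriv (circleMap 0 R) θ) := by
      simp only [deriv_circleMap]; fun_prop
    exact continuous_const.mul (h1.mul (((continuous_circleMap 0 R).pow 2).inv₀ this))
  have hnorm : ∀ θ, ‖circleMap 0 R θ‖ ≤ R := fun θ => by simp [abs_of_pos hR]
  have hrep : ∀ z ∈ ball z0 ε, fderiv ℂ f z v =
      ∫ θ in (0 : ℝ)..2 * Real.pi, c θ • f (z + circleMap 0 R θ • v) := by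
    intro z hz
    have hz' := ball_subset_closedBall hz
    have hzU : z ∈ U := by
      have := hsub (hin z hz' 0 (by simpa using hR.le))
      simpa using this
    have h1 := (line_deriv (f := f) (z := z) (v := v) (ζ := 0)
      (by simpa using hf.differentiableAt (hU.mem_nhds hzU))).deriv
    have hd := line_diff hU hf z v
    have hop : IsOpen {ζ : ℂ | z + ζ • v ∈ U} := hU.preimage (by fun_prop)
    have h2 := Complex.cderiv_eq_deriv hop hd hR (z := 0) (by
      intro ζ hζ
      exact hsub (hin z hz' ζ (by simpa using hζ)))
    simp only [zero_smul, add_zero] at h1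
    rw [← h1, ← h2, cderiv, circleIntegral, ← intervalIntegral.integral_smul]
    simp only [hc, smul_smul, sub_zero, mul_assoc]
  have hcont : ∀ z ∈ ball z0 ε, Continuous (fun θ => c θ • f (z + circleMap 0 R θ • v)) := by
    intro z hz
    refine hcm.smul ?_
    refine (hf.continuousOn.mono hsub).comp_continuous (by fun_prop) ?_
    intro θ; exact hin z (ball_subset_closedBall hz) _ (hnorm θ)
  have hcont' : Continuous (fun θ => c θ • fderiv ℂ f (z0 + circleMap 0 R θ • v)) := by
    refine hcm.smul ?_
    refine (hfc.mono hsub).comp_continuous (by fun_prop) ?_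
    intro θ; exact hin z0 (mem_closedBall_self hε.le) _ (hnorm θ)
  have main := intervalIntegral.hasFDerivAt_integral_of_dominated_of_fderiv_le (𝕜 := ℂ)
    (μ := MeasureTheory.volume) (a := 0) (b := 2 * Real.pi) (x₀ := z0)
    (s := ball z0 ε) (bound := fun θ => ‖c θ‖ * C)
    (F := fun z θ => c θ • f (z + circleMap 0 R θ • v))
    (F' := fun z θ => c θ • fderiv ℂ f (z + circleMap 0 R θ • v))
    (ball_mem_nhds z0 hε)
    (by
      filter_upwards [ball_mem_nhds z0 hε] with z hz
      exact (hcont z hz).aestronglyMeasurable)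
    ((hcont z0 (mem_ball_self hε)).intervalIntegrable _ _)
    hcont'.aestronglyMeasurable
    (by
      refine Filter.Eventually.of_forall fun θ _ z hz => ?_
      rw [norm_smul]
      gcongr
      exact hC _ (hin z (ball_subset_closedBall hz) _ (hnorm θ)))
    ((hcm.norm.mul continuous_const).intervalIntegrable _ _)
    (by
      refine Filter.Eventually.of_forall fun θ _ z hz => ?_
      have hd : HasFDerivAt f (fderiv ℂ f (z + circleMap 0 R θ • v)) (z + circleMap 0 R θ • v) :=
        (hf.differentiableAt (hU.mem_nhds
          (hsub (hin z (ball_subset_closedBall hz) _ (hnorm θ))))).hasFDerivAt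
      have h3 := hd.comp z ((hasFDerivAt_id (𝕜 := ℂ) z).add_const (circleMap 0 R θ • v))
      rw [ContinuousLinearMap.comp_id] at h3
      exact h3.const_smul (c θ))
  refine main.differentiableAt.congr_of_eventuallyEq ?_
  filter_upwards [ball_mem_nhds z0 hε] with z hz
  exact hrep z hz

lemma hol_contDiffOn {U : Set E} (hU : IsOpen U) (n : ℕ) : ∀ {f : E → G},
    DifferentiableOn ℂ f U → ContDiffOn ℂ n f U := by
  induction n with
  | zero => intro f hf; exact contDiffOn_zero.2 hf.continuousOn
  | succ n ih =>
    intro f hf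
    push_cast
    rw [contDiffOn_succ_iff_fderiv_of_isOpen hU]
    refine ⟨hf, by simp, ?_⟩
    exact contDiffOn_clm_apply.2 fun v => ih (fderiv_dir_hol hU hf v)

/-- identity theorem on a ball, along lines -/
lemma hol_zero_ball {z0 : E} {ε : ℝ} {f : E → G} (hf : DifferentiableOn ℂ f (ball z0 ε))
    {z1 : E} (hz1 : z1 ∈ ball z0 ε) (h : ∀ᶠ z in nhds z1, f z = 0) : ∀ z ∈ ball z0 ε, f z = 0 := by
  intro z hz
  have hd := line_diff isOpen_ball hf z1 (z - z1)
  set S : Set ℂ := {ζ | z1 + ζ • (z - z1) ∈ ball z0 ε}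
  have hop : IsOpen S := isOpen_ball.preimage (by fun_prop)
  have hconv : Convex ℝ S := by
    have h1 : Convex ℝ (ball z0 ε) := convex_ball _ _
    intro a ha b hb s t hs ht hst
    have := h1 ha hb hs ht hst
    simp only [S, mem_ofPred_eq] at *
    convert this using 1
    have hs' : s = 1 - t := by linarith
    subst hs'
    simp only [smul_add, add_smul, sub_smul, one_smul, smul_assoc]
    abel
  have h0 : (0 : ℂ) ∈ S := by simpa [S] using hz1
  have h1 : (1 : ℂ) ∈ S := by simpa [S] using hz
  have hev : ∀ᶠ ζ : ℂ in nhds 0, f (z1 + ζ • (z - z1)) = 0 := by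
    have : Tendsto (fun ζ : ℂ => z1 + ζ • (z - z1)) (nhds 0) (nhds z1) := by
      have hc : Continuous (fun ζ : ℂ => z1 + ζ • (z - z1)) := by fun_prop
      simpa using hc.tendsto 0
    exact this.eventually h
  have := (hd.analyticOnNhd hop).eqOn_zero_of_preconnected_of_eventuallyEq_zero
    hconv.isPreconnected h0 hev h1
  simpa using this

/-- identity theorem on a preconnected open set -/
lemma hol_zero_conn {U : Set E} (hU : IsOpen U) (hc : IsPreconnected U) {f : E → G}
    (hf : DifferentiableOn ℂ f U) {z1 : E} (hz1 : z1 ∈ U) (h : ∀ᶠ z in nhds z1, f z = 0) :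
    ∀ z ∈ U, f z = 0 := by
  have key : U ⊆ {z | ∀ᶠ w in nhds z, f w = 0} := by
    apply hc.subset_of_closure_inter_subset
    · exact isOpen_setOfPred_eventually_nhds
    · exact ⟨z1, hz1, h⟩
    · rintro z ⟨hz, hzU⟩
      obtain ⟨δ, hδ, hb⟩ := Metric.isOpen_iff.1 hU z hzU
      obtain ⟨w, hw, hwz⟩ := Metric.mem_closure_iff.1 hz δ hδ
      have := hol_zero_ball (hf.mono hb) (z1 := w) (by rwa [mem_ball, dist_comm]) hw
      filter_upwards [ball_mem_nhds z hδ] with y hy using this y hy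
  exact fun z hz => (key hz).self_of_nhds
end hol

section impl
variable {𝕜 : Type*} [RCLike 𝕜] {E : Type*} [NormedAddCommGroup E] [NormedSpace 𝕜 E]
  [CompleteSpace E]

/-- Implicit functions along a direction. -/
lemma impl_dir {n : WithTop ℕ∞} (hn : n ≠ 0) {ρ : E → 𝕜} {P V : E} (hρ : ContDiffAt 𝕜 n ρ P)
    (h0 : ρ P = 0) (hV : fderiv 𝕜 ρ P V ≠ 0) :
    ∃ T : E → 𝕜, ContDiffAt 𝕜 n T P ∧ T P = 0 ∧ (∀ᶠ X in nhds P, ρ (X + T X • V) = 0) ∧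
      ∀ᶠ X in nhds (P, (0 : 𝕜)), (ρ (X.1 + X.2 • V) = 0 ↔ T X.1 = X.2) := by
  set g : E × 𝕜 → 𝕜 := fun X => ρ (X.1 + X.2 • V) with hg
  have hgc : ContDiffAt 𝕜 n g (P, 0) := by
    have h1 : ContDiffAt 𝕜 n (fun X : E × 𝕜 => X.1 + X.2 • V) (P, 0) := by fun_prop
    exact ContDiffAt.comp (P, (0 : 𝕜)) (g := ρ) (by simpa using hρ) h1
  have hd : fderiv 𝕜 g (P, 0) ∘L .inr 𝕜 E 𝕜 = (1 : 𝕜 →L[𝕜] 𝕜).smulRight (fderiv 𝕜 ρ P V) := by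
    have h1 : HasFDerivAt (fun X : E × 𝕜 => X.1 + X.2 • V)
      (ContinuousLinearMap.fst 𝕜 E 𝕜 + (ContinuousLinearMap.snd 𝕜 E 𝕜).smulRight V) (P, 0) := by
      exact hasFDerivAt_fst.add (hasFDerivAt_snd.smul_const V)
    have h2 : HasFDerivAt ρ (fderiv 𝕜 ρ P) ((P, (0 : 𝕜)).1 + (P, (0 : 𝕜)).2 • V) := by
      simpa using (hρ.differentiableAt hn).hasFDerivAt
    have h3 : HasFDerivAt g _ (P, 0) := h2.comp (P, (0 : 𝕜)) h1
    rw [h3.fderiv]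
    ext; simp
  have hi : (fderiv 𝕜 g (P, 0) ∘L .inr 𝕜 E 𝕜).IsInvertible := by
    rw [hd]
    refine ⟨ContinuousLinearEquiv.smulLeft (Units.mk0 _ hV), ?_⟩
    ext; simp [Units.smul_def]
  refine ⟨hgc.implicitFunction hn hi, hgc.contDiffAt_implicitFunction hn hi,
    hgc.implicitFunction_apply_self hn hi, ?_, ?_⟩
  · have := hgc.eventually_apply_implicitFunction hn hi
    simpa [hg, h0] using this
  · have := hgc.eventually_apply_eq_iff_implicitFunction hn hi
    simpa [hg, h0] using this
end impl

abbrev C4 := C2 × C2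

/-- componentwise conjugation -/
def cj (z : C2) : C2 := ((starRingEnd ℂ) z.1, (starRingEnd ℂ) z.2)

lemma cj_cj (z : C2) : cj (cj z) = z := by simp [cj]
lemma cj_add (z w : C2) : cj (z + w) = cj z + cj w := by simp [cj]
lemma cj_sub (z w : C2) : cj (z - w) = cj z - cj w := by simp [cj]
lemma cj_smul (c : ℂ) (w : C2) : cj (c • w) = (starRingEnd ℂ c) • cj w := by simp [cj]
lemma cj_rsmul (c : ℝ) (w : C2) : cj (c • w) = c • cj w := by
  simp [cj, Prod.smul_def]
lemma cj_cont : Continuous cj := by unfold cj; fun_prop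

def bas : Fin 4 → C2 := ![(1, 0), (I, 0), (0, 1), (0, I)]

def ell : Fin 4 → (C4 →L[ℂ] ℂ) :=
  let x1 : C4 →L[ℂ] ℂ := ContinuousLinearMap.fst ℂ ℂ ℂ ∘L ContinuousLinearMap.fst ℂ C2 C2
  let x2 : C4 →L[ℂ] ℂ := ContinuousLinearMap.snd ℂ ℂ ℂ ∘L ContinuousLinearMap.fst ℂ C2 C2
  let y1 : C4 →L[ℂ] ℂ := ContinuousLinearMap.fst ℂ ℂ ℂ ∘L ContinuousLinearMap.snd ℂ C2 C2
  let y2 : C4 →L[ℂ] ℂ := ContinuousLinearMap.snd ℂ ℂ ℂ ∘L ContinuousLinearMap.snd ℂ C2 C2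
  ![(1 / 2 : ℂ) • (x1 + y1), (-I / 2 : ℂ) • (x1 - y1), (1 / 2 : ℂ) • (x2 + y2),
    (-I / 2 : ℂ) • (x2 - y2)]

def co : Fin 4 → C2 → ℝ := fun j z => ![z.1.re, z.1.im, z.2.re, z.2.im] j

lemma bas_sum (z : C2) : ∑ j, co j z • bas j = z := by
  simp only [Fin.sum_univ_four, bas, co]
  ext <;> simp [Complex.ext_iff]

lemma bas_norm (j : Fin 4) : ‖bas j‖ ≤ 1 := by
  fin_cases j <;> simp [bas, Prod.norm_def]

lemma ell_co (j : Fin 4) (z : C2) : ell j (z, cj z) = (co j z : ℂ) := by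
  fin_cases j <;> simp [ell, co, cj] <;> apply Complex.ext <;> simp <;> ring

lemma ell_norm (j : Fin 4) : ‖ell j‖ ≤ 1 := by
  apply ContinuousLinearMap.opNorm_le_bound _ zero_le_one
  rintro ⟨⟨x1, x2⟩, ⟨y1, y2⟩⟩
  have key : ∀ a b c : ℂ, ‖c‖ ≤ 1 / 2 → ∀ N : ℝ, ‖a‖ ≤ N → ‖b‖ ≤ N → ‖c * (a + b)‖ ≤ N := by
    intro a b c hc N ha hb
    rw [norm_mul]
    nlinarith [norm_add_le a b, norm_nonneg c, norm_nonneg (a + b)]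
  have key2 : ∀ a b c : ℂ, ‖c‖ ≤ 1 / 2 → ∀ N : ℝ, ‖a‖ ≤ N → ‖b‖ ≤ N → ‖c * (a - b)‖ ≤ N := by
    intro a b c hc N ha hb
    rw [sub_eq_add_neg]
    exact key a (-b) c hc N ha (by rwa [norm_neg])
  have hx1 : ‖x1‖ ≤ ‖(((x1, x2), (y1, y2)) : C4)‖ := by simp [Prod.norm_def]
  have hx2 : ‖x2‖ ≤ ‖(((x1, x2), (y1, y2)) : C4)‖ := by simp [Prod.norm_def]
  have hy1 : ‖y1‖ ≤ ‖(((x1, x2), (y1, y2)) : C4)‖ := by simp [Prod.norm_def]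
  have hy2 : ‖y2‖ ≤ ‖(((x1, x2), (y1, y2)) : C4)‖ := by simp [Prod.norm_def]
  rw [one_mul]
  fin_cases j
  · exact key x1 y1 (1 / 2) (by norm_num) _ hx1 hy1
  · exact key2 x1 y1 (-I / 2) (by norm_num) _ hx1 hy1
  · exact key x2 y2 (1 / 2) (by norm_num) _ hx2 hy2
  · exact key2 x2 y2 (-I / 2) (by norm_num) _ hx2 hy2

def cplx (q : FormalMultilinearSeries ℝ C2 ℝ) : FormalMultilinearSeries ℂ C4 ℂ := fun n =>
  ∑ J : Fin n → Fin 4, ((q n (fun i => bas (J i)) : ℝ) : ℂ) •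
    (ContinuousMultilinearMap.mkPiAlgebra ℂ (Fin n) ℂ).compContinuousLinearMap (fun i => ell (J i))

lemma cplx_norm (q : FormalMultilinearSeries ℝ C2 ℝ) (n : ℕ) : ‖cplx q n‖ ≤ 4 ^ n * ‖q n‖ := by
  unfold cplx
  refine (norm_sum_le _ _).trans ?_
  have : ∀ J ∈ (Finset.univ : Finset (Fin n → Fin 4)), ‖((q n (fun i => bas (J i)) : ℝ) : ℂ) •
    (ContinuousMultilinearMap.mkPiAlgebra ℂ (Fin n) ℂ).compContinuousLinearMap
      (fun i => ell (J i))‖ ≤ ‖q n‖ := by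
    intro J _
    rw [norm_smul, Complex.norm_real]
    have h1 : ‖q n (fun i => bas (J i))‖ ≤ ‖q n‖ := by
      refine ((q n).le_opNorm _).trans ?_
      exact mul_le_of_le_one_right (norm_nonneg _)
        (Finset.prod_le_one (fun _ _ => norm_nonneg _) (fun i _ => bas_norm _))
    have h2 : ‖(ContinuousMultilinearMap.mkPiAlgebra ℂ (Fin n) ℂ).compContinuousLinearMap
      (fun i => ell (J i))‖ ≤ 1 := by
      refine (ContinuousMultilinearMap.norm_compContinuousLinearMap_le _ _).trans ?_
      rw [ContinuousMultilinearMap.norm_mkPiAlgebra, one_mul]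
      exact Finset.prod_le_one (fun _ _ => norm_nonneg _) (fun i _ => ell_norm _)
    exact (mul_le_mul h1 h2 (norm_nonneg _) (norm_nonneg _)).trans (mul_one _).le
  refine (Finset.sum_le_sum this).trans ?_
  simp

lemma cplx_apply (q : FormalMultilinearSeries ℝ C2 ℝ) (n : ℕ) (z : C2) :
    cplx q n (fun _ => (z, cj z)) = ((q n (fun _ => z) : ℝ) : ℂ) := by
  have h : q n (fun _ => z) = ∑ J : Fin n → Fin 4, (∏ i, co (J i) z) * q n (fun i => bas (J i)) := by
    conv_lhs => rw [← bas_sum z]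
    rw [(q n).map_sum]
    refine Finset.sum_congr rfl fun J _ => ?_
    rw [(q n).map_smul_univ (fun i => co (J i) z) (fun i => bas (J i))]
    rfl
  rw [h, cplx]
  simp [ell_co, mul_comm]

lemma cplx_radius (q : FormalMultilinearSeries ℝ C2 ℝ) (h : 0 < q.radius) :
    0 < (cplx q).radius := by
  obtain ⟨s, hs0, hs⟩ := ENNReal.lt_iff_exists_nnreal_btwn.1 h
  obtain ⟨C, hC, hb⟩ := q.norm_mul_pow_le_of_lt_radius hs
  have : ((s / 4 : NNReal) : ENNReal) ≤ (cplx q).radius := by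
    apply FormalMultilinearSeries.le_radius_of_bound _ C
    intro n
    refine le_trans ?_ (hb n)
    push_cast
    rw [div_pow]
    calc ‖cplx q n‖ * ((s : ℝ) ^ n / 4 ^ n) ≤ (4 ^ n * ‖q n‖) * ((s : ℝ) ^ n / 4 ^ n) := by
          gcongr; exact cplx_norm q n
      _ = _ := by field_simp
  refine lt_of_lt_of_le ?_ this
  simp only [ENNReal.coe_pos] at hs0 ⊢
  positivity

lemma exists_cplx {r : C2 → ℝ} {p : C2} (hr : AnalyticAt ℝ r p) :
    ∃ ρ : C4 → ℂ, AnalyticAt ℂ ρ (p, cj p) ∧ ∀ᶠ z in nhds p, ρ (z, cj z) = r z := by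
  obtain ⟨q, R, hq⟩ := hr
  have hpos : 0 < (cplx q).radius := cplx_radius q (hq.r_pos.trans_le hq.r_le)
  have hP := (cplx q).hasFPowerSeriesOnBall hpos
  refine ⟨fun X => (cplx q).sum (X - (p, cj p)), ?_, ?_⟩
  · have : AnalyticAt ℂ (cplx q).sum ((p, cj p) - (p, cj p) : C4) := by
      rw [sub_self]; exact hP.analyticAt
    exact AnalyticAt.comp (g := (cplx q).sum) (f := fun X : C4 => X - (p, cj p)) this
      (analyticAt_id.sub analyticAt_const)
  · filter_upwards [Metric.eball_mem_nhds p hq.r_pos] with z hz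
    have h1 := hq.hasSum_sub hz
    have h2 : ((z, cj z) - (p, cj p) : C4) = (z - p, cj (z - p)) := by
      simp [cj_sub]
    rw [h2, FormalMultilinearSeries.sum]
    simp only [cplx_apply]
    rw [← h1.tsum_eq, Complex.ofReal_tsum]

lemma cj_norm (z : C2) : ‖cj z‖ = ‖z‖ := by simp [cj, Prod.norm_def]

lemma freq_of_real {P : ℂ → Prop} {ε : ℝ} (hε : 0 < ε) (h : ∀ t : ℝ, |t| < ε → P t) :
    ∃ᶠ l in nhdsWithin (0 : ℂ) {0}ᶜ, P l := by
  have ht : Tendsto (fun t : ℝ => (t : ℂ)) (nhdsWithin 0 {0}ᶜ) (nhdsWithin (0 : ℂ) {0}ᶜ) := by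
    apply tendsto_nhdsWithin_of_tendsto_nhds_of_eventually_within
    · exact (Complex.continuous_ofReal.tendsto' 0 0 (by simp)).mono_left nhdsWithin_le_nhds
    · filter_upwards [self_mem_nhdsWithin] with t ht
      simpa using ht
  refine ht.frequently (Filter.Eventually.frequently ?_)
  filter_upwards [nhdsWithin_le_nhds (ball_mem_nhds (0 : ℝ) hε)] with t ht
  exact h t (by simpa using ht)

/-- identity theorem: a holomorphic function vanishing on the totally real set `(z, conj z)`. -/
lemma tr_identity {K : C4 → ℂ} {p : C2} (hK : ∀ᶠ X in nhds ((p, cj p) : C4), DifferentiableAt ℂ K X)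
    (h : ∀ᶠ z in nhds p, K (z, cj z) = 0) : ∀ᶠ X in nhds ((p, cj p) : C4), K X = 0 := by
  obtain ⟨ε, hε, hd⟩ := Metric.eventually_nhds_iff.1 hK
  obtain ⟨η, hη, hz⟩ := Metric.eventually_nhds_iff.1 h
  rw [Metric.eventually_nhds_iff]
  refine ⟨min ε η / 4, by positivity, ?_⟩
  rintro ⟨x, y⟩ hX
  set N := ‖((x - p, y - cj p) : C4)‖ with hN
  have hN' : N < min ε η / 4 := by
    rw [dist_eq_norm] at hX; exact hX
  have hx : ‖x - p‖ ≤ N := by simp [hN, Prod.norm_def (E := C2)]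
  have hy : ‖y - cj p‖ ≤ N := by simp [hN, Prod.norm_def (E := C2)]
  set u : C2 := (1 / 2 : ℂ) • ((x - p) + cj (y - cj p)) with hu
  set v : C2 := (-I / 2 : ℂ) • ((x - p) - cj (y - cj p)) with hv
  have hun : ‖u‖ ≤ N := by
    rw [hu, norm_smul]
    have := norm_add_le (x - p) (cj (y - cj p))
    rw [cj_norm] at this
    norm_num; linarith
  have hvn : ‖v‖ ≤ N := by
    rw [hv, norm_smul]
    have := norm_sub_le (x - p) (cj (y - cj p))
    rw [cj_norm] at this
    norm_num; linarith
  have hpt : ∀ l : ℂ, ‖l‖ < 2 → ‖(u + l • v, cj u + l • cj v)‖ ≤ 3 * N := by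
    intro l hl
    have h1 : ‖l • v‖ ≤ 2 * N := by
      rw [norm_smul]
      exact mul_le_mul hl.le hvn (norm_nonneg _) (by norm_num)
    have h2 : ‖l • cj v‖ ≤ 2 * N := by
      rw [norm_smul, cj_norm]
      exact mul_le_mul hl.le hvn (norm_nonneg _) (by norm_num)
    rw [Prod.norm_def]
    apply max_le
    · exact (norm_add_le _ _).trans (by linarith)
    · exact (norm_add_le _ _).trans (by rw [cj_norm]; linarith)
  have hNε : 3 * N < ε := by
    have := min_le_left ε η
    have : 0 ≤ N := norm_nonneg _
    linarith
  have hNη : 3 * N < η := by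
    have := min_le_right ε η
    have : 0 ≤ N := norm_nonneg _
    linarith
  have hdist : ∀ l : ℂ, ‖l‖ < 2 → dist ((p + u + l • v, cj p + cj u + l • cj v) : C4) (p, cj p) ≤ 3 * N := by
    intro l hl
    rw [dist_eq_norm]
    have h0 : ((p + u + l • v, cj p + cj u + l • cj v) : C4) - (p, cj p)
        = (u + l • v, cj u + l • cj v) := by
      refine Prod.ext ?_ ?_ <;> simp only [Prod.fst_sub, Prod.snd_sub] <;> abel
    rw [h0]; exact hpt l hl
  have hg : DifferentiableOn ℂ (fun l : ℂ => K (p + u + l • v, cj p + cj u + l • cj v)) (ball 0 2) := by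
    intro l hl
    have h1 : DifferentiableAt ℂ (fun l : ℂ => ((p + u + l • v, cj p + cj u + l • cj v) : C4)) l := by
      fun_prop
    exact (DifferentiableAt.comp l (hd ((hdist l (by simpa using hl)).trans_lt hNε)) h1).differentiableWithinAt
  have hfreq : ∃ᶠ l in nhdsWithin (0 : ℂ) {0}ᶜ, K (p + u + l • v, cj p + cj u + l • cj v) = 0 := by
    apply freq_of_real (ε := 2) two_pos
    intro t ht
    have h1 : cj p + cj u + (t : ℂ) • cj v = cj (p + u + (t : ℂ) • v) := by
      rw [cj_add, cj_add, cj_smul (t : ℂ) v, conj_ofReal]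
    rw [h1]
    apply hz
    have h2 := hdist t (by simpa using ht)
    rw [Prod.dist_eq] at h2
    exact (le_max_left _ _).trans h2 |>.trans_lt hNη
  have := (hg.analyticOnNhd isOpen_ball).eqOn_zero_of_preconnected_of_frequently_eq_zero
    (convex_ball _ _).isPreconnected (mem_ball_self two_pos) hfreq
  have hI := this (x := I) (by simp)
  simp only [Pi.zero_apply] at hI
  convert hI using 2
  have hII : I * (-I / 2) = 1 / 2 := by
    rw [mul_div_assoc', mul_neg, I_mul_I]; norm_num
  have hII' : I * (starRingEnd ℂ) (-I / 2) = -(1 / 2) := by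
    simp only [map_div₀, map_neg, conj_I, neg_neg, map_ofNat]
    rw [mul_div_assoc', I_mul_I]; norm_num
  refine Prod.ext ?_ ?_
  · simp only [hu, hv, smul_smul, hII, smul_sub, smul_add]
    rw [show p + (((1 / 2 : ℂ) • x - (1 / 2 : ℂ) • p) + (1 / 2 : ℂ) • cj (y - cj p))
      + (((1 / 2 : ℂ) • x - (1 / 2 : ℂ) • p) - (1 / 2 : ℂ) • cj (y - cj p)) =
        p + ((1 / 2 : ℂ) + 1 / 2) • (x - p) by module]
    norm_num
  · simp only [hu, hv, cj_smul, smul_smul, hII', cj_add, cj_sub, cj_cj]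
    rw [map_div₀, map_one, map_ofNat]
    rw [show cj p + (1 / 2 : ℂ) • ((cj x - cj p) + (y - cj p))
      + (-(1 / 2) : ℂ) • ((cj x - cj p) - (y - cj p)) =
        cj p + ((1 / 2 : ℂ) + 1 / 2) • (y - cj p) by module]
    norm_num

/-- the totally real embedding as a real-linear map -/
def iota : C2 →L[ℝ] C4 :=
  (ContinuousLinearMap.id ℝ C2).prod
    (((conjCLE : ℂ →L[ℝ] ℂ).comp (ContinuousLinearMap.fst ℝ ℂ ℂ)).prod
      ((conjCLE : ℂ →L[ℝ] ℂ).comp (ContinuousLinearMap.snd ℝ ℂ ℂ)))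

lemma iota_apply (z : C2) : iota z = (z, cj z) := rfl

lemma fderiv_cplx {ρ : C4 → ℂ} {r : C2 → ℝ} {p : C2} (hρ : AnalyticAt ℂ ρ (p, cj p))
    (hr : DifferentiableAt ℝ r p)
    (h : ∀ᶠ z in nhds p, ρ (z, cj z) = r z) (v : C2) :
    fderiv ℂ ρ (p, cj p) (v, cj v) = (fderiv ℝ r p v : ℂ) := by
  have h1 : HasFDerivAt ρ ((fderiv ℂ ρ (p, cj p)).restrictScalars ℝ) (iota p) :=
    hρ.differentiableAt.hasFDerivAt.restrictScalars ℝ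
  have h2 : HasFDerivAt (fun z => ρ (iota z)) _ p := h1.comp p iota.hasFDerivAt
  have h3 : HasFDerivAt (fun z => (r z : ℂ)) _ p := Complex.ofRealCLM.hasFDerivAt.comp p hr.hasFDerivAt
  have h4 := (h3.congr_of_eventuallyEq h).unique h2
  have := DFunLike.congr_fun h4 v
  simpa [iota_apply] using this.symm

lemma fderiv_cplx_ne {ρ : C4 → ℂ} {r : C2 → ℝ} {p : C2} (hρ : AnalyticAt ℂ ρ (p, cj p))
    (hr : DifferentiableAt ℝ r p)
    (h : ∀ᶠ z in nhds p, ρ (z, cj z) = r z) {e : C2} (he : fderiv ℝ r p e ≠ 0) :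
    fderiv ℂ ρ (p, cj p) (e, 0) ≠ 0 ∧ fderiv ℂ ρ (p, cj p) (0, cj e) ≠ 0 := by
  have h1 := fderiv_cplx hρ hr h e
  have h2 := fderiv_cplx hρ hr h (I • e)
  set L := fderiv ℂ ρ (p, cj p)
  have e1 : L (e, cj e) = L (e, 0) + L (0, cj e) := by rw [← map_add]; simp
  have e2 : L (I • e, cj (I • e)) = I * L (e, 0) - I * L (0, cj e) := by
    rw [cj_smul, conj_I, ← smul_eq_mul, ← smul_eq_mul, ← map_smul, ← map_smul, ← map_sub]
    simp
  rw [e1] at h1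
  rw [e2] at h2
  rw [Complex.ext_iff] at h1 h2
  simp at h1 h2
  constructor <;> intro h0 <;> rw [h0] at h1 h2 <;> simp at h1 h2 <;> apply he <;> linarith [h1.1]

lemma exists_dir {r : C2 → ℝ} {p : C2} (h : fderiv ℝ r p ≠ 0) : ∃ e, fderiv ℝ r p e ≠ 0 := by
  by_contra! hc
  exact h (ContinuousLinearMap.ext fun v => by simpa using hc v)

/-- A holomorphic function vanishing on the diagonal of `{r = 0}` vanishes on `{ρ = 0}`. -/
lemma segre_vanish {ρ : C4 → ℂ} {r : C2 → ℝ} {p : C2} (hρ : AnalyticAt ℂ ρ (p, cj p))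
    (hr : AnalyticAt ℝ r p) (hr0 : r p = 0) (hdr : fderiv ℝ r p ≠ 0)
    (h : ∀ᶠ z in nhds p, ρ (z, cj z) = r z) {H : C4 → ℂ}
    (hH : ∀ᶠ X in nhds ((p, cj p) : C4), DifferentiableAt ℂ H X)
    (hH0 : ∀ᶠ z in nhds p, r z = 0 → H (z, cj z) = 0) :
    ∀ᶠ X in nhds ((p, cj p) : C4), ρ X = 0 → H X = 0 := by
  obtain ⟨e, he⟩ := exists_dir hdr
  have hρ0 : ρ (p, cj p) = 0 := by rw [h.self_of_nhds, hr0]; simp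
  have hE : fderiv ℂ ρ (p, cj p) (e, cj e) ≠ 0 := by
    rw [fderiv_cplx hρ hr.differentiableAt h]; exact_mod_cast he
  obtain ⟨T, hTc, hT0, hT1, hT2⟩ := impl_dir (n := 1) one_ne_zero hρ.contDiffAt hρ0 hE
  obtain ⟨Tr, hrc, hr0', hr1, hr2⟩ := impl_dir (n := 1) one_ne_zero hr.contDiffAt hr0 he
  -- T is real at real points
  have hTr : ∀ᶠ z in nhds p, T (z, cj z) = Tr z := by
    have hc1 : ContinuousAt (fun z : C2 => (((z, cj z), (Tr z : ℂ)) : C4 × ℂ)) p := by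
      have : ContinuousAt (fun z => (Tr z : ℂ)) p :=
        Complex.continuous_ofReal.continuousAt.comp hrc.continuousAt
      exact (continuousAt_id.prodMk cj_cont.continuousAt).prodMk this
    have hc2 : ContinuousAt (fun z : C2 => z + Tr z • e) p := by
      exact continuousAt_id.add (hrc.continuousAt.smul continuousAt_const)
    have a1 := hc1.eventually (by simpa [hr0'] using hT2)
    have a2 := hc2.eventually (by simpa [hr0'] using h)
    filter_upwards [a1, a2, hr1] with z b1 b2 b3
    rw [b3] at b2
    apply b1.1
    convert b2 using 2
    · simp [cj_add, cj_rsmul]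
    · simp
  have hTd : ∀ᶠ X in nhds ((p, cj p) : C4), DifferentiableAt ℂ T X :=
    (hTc.eventually (by simp)).mono fun X hX => hX.differentiableAt one_ne_zero
  have hXT : ContinuousAt (fun X : C4 => X + T X • ((e, cj e) : C4)) (p, cj p) :=
    continuousAt_id.add (hTc.continuousAt.smul continuousAt_const)
  have hK : ∀ᶠ X in nhds ((p, cj p) : C4), H (X + T X • ((e, cj e) : C4)) = 0 := by
    apply tr_identity
    · have := hXT.eventually (by simpa [hT0] using hH)
      filter_upwards [this, hTd] with X h1 h2
      exact DifferentiableAt.comp X h1 (differentiableAt_id.add (h2.smul_const _))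
    · have hc2 : ContinuousAt (fun z : C2 => z + Tr z • e) p := by
        exact continuousAt_id.add (hrc.continuousAt.smul continuousAt_const)
      have a2 := hc2.eventually (by simpa [hr0'] using hH0)
      filter_upwards [hTr, hr1, a2] with z b1 b2 b3
      rw [b1]
      convert b3 b2 using 2
      simp [cj_add, cj_rsmul]
  have hc3 : ContinuousAt (fun X : C4 => (X, (0 : ℂ))) (p, cj p) := by fun_prop
  filter_upwards [hK, hc3.eventually hT2] with X h1 h2 h3
  have : T X = 0 := h2.1 (by simpa using h3)
  simpa [this] using h1

/-- A holomorphic function vanishing on a piece of `{r = 0}` vanishes near it. -/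
lemma hol_vanish {r : C2 → ℝ} {p : C2}
    (hr : AnalyticAt ℝ r p) (hr0 : r p = 0) (hdr : fderiv ℝ r p ≠ 0) {J : C2 → ℂ}
    (hJ : ∀ᶠ z in nhds p, DifferentiableAt ℂ J z) (hJ0 : ∀ᶠ z in nhds p, r z = 0 → J z = 0) :
    ∀ᶠ z in nhds p, J z = 0 := by
  obtain ⟨ρ, hρ, h⟩ := exists_cplx hr
  obtain ⟨e, he⟩ := exists_dir hdr
  have hρ0 : ρ (p, cj p) = 0 := by rw [h.self_of_nhds, hr0]; simp
  have hE := (fderiv_cplx_ne hρ hr.differentiableAt h he).2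
  obtain ⟨T, hTc, hT0, hT1, hT2⟩ := impl_dir (n := 1) one_ne_zero hρ.contDiffAt hρ0 hE
  have hS := segre_vanish hρ hr hr0 hdr h (H := fun X => J X.1)
    (by
      have hc : ContinuousAt (fun X : C4 => X.1) (p, cj p) := continuousAt_fst
      filter_upwards [hc.eventually hJ] with X hX
      exact DifferentiableAt.comp X hX differentiableAt_fst) hJ0
  have hXT : ContinuousAt (fun X : C4 => X + T X • ((0, cj e) : C4)) (p, cj p) :=
    continuousAt_id.add (hTc.continuousAt.smul continuousAt_const)
  have hx : ContinuousAt (fun x : C2 => ((x, cj p) : C4)) p := by fun_prop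
  filter_upwards [hx.eventually hT1, hx.eventually (hXT.eventually (by simpa [hT0] using hS))] with x h1 h2
  simpa using h2 h1

/-- complex Jacobian determinant -/
def jac (F : C2 → C2) (z : C2) : ℂ :=
  (fderiv ℂ F z (1, 0)).1 * (fderiv ℂ F z (0, 1)).2 -
    (fderiv ℂ F z (0, 1)).1 * (fderiv ℂ F z (1, 0)).2

lemma jac_hol {F : C2 → C2} {U : Set C2} (hU : IsOpen U) (hF : DifferentiableOn ℂ F U) :
    DifferentiableOn ℂ (jac F) U := by
  have h1 := fderiv_dir_hol hU hF (1, 0)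
  have h2 := fderiv_dir_hol hU hF (0, 1)
  unfold jac
  exact (h1.fst.mul h2.snd).sub (h2.fst.mul h1.snd)

lemma jac_zero_of_functional {F : C2 → C2} {z : C2} (L : C2 →L[ℂ] ℂ) (hL : L ≠ 0)
    (h : ∀ v, L (fderiv ℂ F z v) = 0) : jac F z = 0 := by
  have hl : ∀ w : C2, L w = w.1 * L (1, 0) + w.2 * L (0, 1) := by
    intro w
    rw [← smul_eq_mul, ← smul_eq_mul, ← map_smul, ← map_smul, ← map_add]
    simp
  have h1 := h (1, 0)
  have h2 := h (0, 1)
  rw [hl] at h1 h2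
  unfold jac
  by_cases ha : L (1, 0) = 0
  · by_cases hb : L (0, 1) = 0
    · exfalso; apply hL
      refine ContinuousLinearMap.ext fun w => ?_
      rw [hl, ha, hb]; simp
    · apply mul_right_cancel₀ hb
      rw [ha] at h1 h2
      linear_combination (fderiv ℂ F z (1, 0)).1 * h2 - (fderiv ℂ F z (0, 1)).1 * h1
  · apply mul_right_cancel₀ ha
    linear_combination (fderiv ℂ F z (0, 1)).2 * h1 - (fderiv ℂ F z (1, 0)).2 * h2

lemma conj_hol {F : C2 → C2} {y : C2} (hF : DifferentiableAt ℂ F (cj y)) :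
    DifferentiableAt ℂ (fun w => cj (F (cj w))) y := by
  obtain ⟨L, hL⟩ := hF
  let L' : C2 →ₗ[ℂ] C2 :=
    { toFun := fun w => cj (L (cj w))
      map_add' := fun a b => by rw [cj_add, map_add, cj_add]
      map_smul' := fun c a => by rw [cj_smul, map_smul, cj_smul, conj_conj]; rfl }
  refine ⟨LinearMap.toContinuousLinearMap L', ?_⟩
  rw [hasFDerivAt_iff_isLittleO_nhds_zero] at hL ⊢
  have ht : Tendsto cj (nhds 0) (nhds 0) :=
    cj_cont.tendsto' 0 0 (by ext <;> simp [cj])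
  have h1 := hL.comp_tendsto ht
  rw [← Asymptotics.isLittleO_norm_norm] at h1 ⊢
  refine h1.congr (fun h => ?_) (fun h => ?_)
  · simp only [Function.comp]
    rw [← cj_norm]
    congr 1
    simp only [cj_sub, cj_add]
    rfl
  · simp [cj_norm]

lemma G_nonzero {F : C2 → C2} {p : C2} {ρ' : C4 → ℂ}
    (hF : ∀ᶠ z in nhds p, DifferentiableAt ℂ F z) (hρ' : AnalyticAt ℂ ρ' (F p, cj (F p)))
    {e' : C2} (he' : fderiv ℂ ρ' (F p, cj (F p)) (e', 0) ≠ 0)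
    (hJ : ¬ ∀ᶠ z in nhds p, jac F z = 0) :
    ¬ ∀ᶠ z in nhds p, ρ' (F z, cj (F p)) = 0 := by
  intro h
  apply hJ
  have hFc : ContinuousAt F p := hF.self_of_nhds.continuousAt
  have hc : ContinuousAt (fun z => ((F z, cj (F p)) : C4)) p := hFc.prodMk continuousAt_const
  have h1 : ∀ᶠ z in nhds p, AnalyticAt ℂ ρ' (F z, cj (F p)) :=
    hc.eventually hρ'.eventually_analyticAt
  have h2 : ∀ᶠ z in nhds p, fderiv ℂ ρ' (F z, cj (F p)) (e', 0) ≠ 0 := by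
    have h3 : ContinuousAt (fun X => fderiv ℂ ρ' X (e', 0)) (F p, cj (F p)) :=
      hρ'.fderiv.continuousAt.clm_apply continuousAt_const
    have h4 : ContinuousAt (fun z => fderiv ℂ ρ' (F z, cj (F p)) (e', 0)) p :=
      ContinuousAt.comp (g := fun X => fderiv ℂ ρ' X (e', 0)) h3 hc
    exact h4.eventually_ne he'
  filter_upwards [h1, h2, hF, h.eventually_nhds] with z h1 h2 h3 h4
  refine jac_zero_of_functional
    ((fderiv ℂ ρ' (F z, cj (F p))).comp (ContinuousLinearMap.inl ℂ C2 C2)) ?_ ?_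
  · intro h0
    apply h2
    have := DFunLike.congr_fun h0 e'
    simpa using this
  · intro v
    have h5 : HasFDerivAt (fun z => ((F z, cj (F p)) : C4)) ((fderiv ℂ F z).prod 0) z :=
      h3.hasFDerivAt.prodMk (hasFDerivAt_const _ _)
    have h6 : HasFDerivAt (fun z => ρ' (F z, cj (F p))) _ z :=
      h1.differentiableAt.hasFDerivAt.comp z h5
    have h7 := ((hasFDerivAt_const (0 : ℂ) z).congr_of_eventuallyEq h4).unique h6
    have := DFunLike.congr_fun h7 v
    simpa using this.symm

/-- coordinates with respect to a basis `b, e` -/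
lemma coords (e : C2) (he : e ≠ 0) : ∃ b : C2, ∃ z t : C2 →L[ℂ] ℂ, (∀ x, x = z x • b + t x • e) ∧
    (∀ c d : ℂ, c • b + d • e = 0 → c = 0) := by
  set n : ℂ := e.1 * (starRingEnd ℂ) e.1 + e.2 * (starRingEnd ℂ) e.2 with hn
  have hn0 : n ≠ 0 := by
    intro h0
    apply he
    rw [hn, mul_conj, mul_conj] at h0
    have h1 : normSq e.1 + normSq e.2 = 0 := by exact_mod_cast h0
    have h2 := normSq_nonneg e.1
    have h3 := normSq_nonneg e.2
    ext
    · simpa using normSq_eq_zero.1 (by linarith)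
    · simpa using normSq_eq_zero.1 (by linarith)
  let x1 : C2 →L[ℂ] ℂ := ContinuousLinearMap.fst ℂ ℂ ℂ
  let x2 : C2 →L[ℂ] ℂ := ContinuousLinearMap.snd ℂ ℂ ℂ
  refine ⟨(-(starRingEnd ℂ) e.2, (starRingEnd ℂ) e.1), n⁻¹ • (e.1 • x2 - e.2 • x1),
    n⁻¹ • ((starRingEnd ℂ) e.1 • x1 + (starRingEnd ℂ) e.2 • x2), ?_, ?_⟩
  · intro x
    ext <;> simp [x1, x2] <;> field_simp <;> rw [hn] <;> ring
  · intro c d h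
    have h1 := congrArg Prod.fst h
    have h2 := congrArg Prod.snd h
    simp at h1 h2
    apply mul_right_cancel₀ hn0
    rw [hn]
    linear_combination e.1 * h2 - e.2 * h1

/-- Baire category step -/
lemma baire_eq {g : ℕ → ℂ → ℂ} {g0 : ℂ → ℂ} {δ : ℝ} {k0 : ℕ}
    (hg : ∀ k ≥ k0, DifferentiableOn ℂ (g k) (ball 0 δ)) (hg0 : DifferentiableOn ℂ g0 (ball 0 δ))
    {N : Set ℂ} (hN : IsOpen N) (hNs : N ⊆ ball 0 δ) {ζ0 : ℂ} (hζ0 : ζ0 ∈ N)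
    (h : ∀ ζ ∈ N, ∀ᶠ k in atTop, g k ζ = g0 ζ) :
    ∃ K ≥ k0, ∀ k ≥ K, ∀ ζ ∈ ball 0 δ, g k ζ = g0 ζ := by
  obtain ⟨η, hη, hb⟩ := Metric.nhds_basis_closedBall.mem_iff.1 (hN.mem_nhds hζ0)
  set A : ℕ → Set ℂ := fun K => ⋂ k : ℕ, (if max K k0 ≤ k then
    {ζ ∈ closedBall ζ0 η | g k ζ - g0 ζ ∈ ({0} : Set ℂ)} else univ) ∪ (ball ζ0 η)ᶜ with hA
  have hclosed : ∀ K, IsClosed (A K) := by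
    intro K
    refine isClosed_iInter fun k => IsClosed.union ?_ isOpen_ball.isClosed_compl
    split_ifs with hk
    · refine ContinuousOn.preimage_isClosed_of_isClosed
        (ContinuousOn.sub ?_ ?_) isClosed_closedBall isClosed_singleton
      · exact ((hg k ((le_max_right _ _).trans hk)).continuousOn.mono (hb.trans hNs))
      · exact hg0.continuousOn.mono (hb.trans hNs)
    · exact isClosed_univ
  have hU : ⋃ K, A K = univ := by
    rw [eq_univ_iff_forall]
    intro ζ
    rw [mem_iUnion]
    by_cases hζ : ζ ∈ ball ζ0 η
    · obtain ⟨K, hK⟩ := eventually_atTop.1 (h ζ (hb (ball_subset_closedBall hζ)))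
      refine ⟨K, mem_iInter.2 fun k => Or.inl ?_⟩
      split_ifs with hk
      · exact ⟨ball_subset_closedBall hζ, by
          simp [hK k ((le_max_left _ _).trans hk)]⟩
      · trivial
    · exact ⟨0, mem_iInter.2 fun k => Or.inr hζ⟩
  have hdense := dense_iUnion_interior_of_closed hclosed hU
  obtain ⟨ζ1, h1, h2⟩ := hdense.inter_open_nonempty (ball ζ0 η) isOpen_ball ⟨ζ0, mem_ball_self hη⟩
  obtain ⟨K, hK⟩ := mem_iUnion.1 h2
  refine ⟨max K k0, le_max_right _ _, fun k hk ζ hζ => ?_⟩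
  have hz := hol_zero_ball (f := fun ζ => g k ζ - g0 ζ) (z1 := ζ1)
    ((hg k ((le_max_right _ _).trans hk)).sub hg0) (hNs (hb (ball_subset_closedBall h1)))
    (by
      filter_upwards [isOpen_interior.mem_nhds hK, isOpen_ball.mem_nhds h1] with w hw hw'
      have := mem_iInter.1 (interior_subset hw) k
      rw [if_pos hk] at this
      rcases this with this | this
      · exact this.2
      · exact absurd hw' this) ζ hζ
  exact sub_eq_zero.1 hz

lemma eventually_ball2 {α : Type*} [PseudoMetricSpace α] {Q : ℂ × α → Prop} {p : α}
    (h : ∀ᶠ X in nhds ((0 : ℂ), p), Q X) :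
    ∃ δ > 0, ∀ ζ : ℂ, ‖ζ‖ < δ → ∀ a, dist a p < δ → Q (ζ, a) := by
  obtain ⟨δ, hδ, hQ⟩ := Metric.eventually_nhds_iff.1 h
  refine ⟨δ, hδ, fun ζ hζ a ha => hQ ?_⟩
  rw [Prod.dist_eq]
  exact max_lt (by simpa using hζ) ha

theorem ca_tendsto {X Y : Type*} [TopologicalSpace X] [TopologicalSpace Y] {f : X → Y} {x : X} {y : Y}
    (h : ContinuousAt f x) (e : f x = y) : Tendsto f (nhds x) (nhds y) := e ▸ h

set_option maxHeartbeats 1000000 in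
theorem isolated_fiber {r r' : C2 → ℝ} {p : C2} {F : C2 → C2} {U : Set C2}
    (hr : AnalyticAt ℝ r p) (hr0 : r p = 0) (hdr : fderiv ℝ r p ≠ 0)
    (hr' : AnalyticAt ℝ r' (F p)) (hdr' : fderiv ℝ r' (F p) ≠ 0)
    (hF : ∀ᶠ z in nhds p, DifferentiableAt ℂ F z)
    (hFM : ∀ᶠ z in nhds p, r z = 0 → r' (F z) = 0)
    (hJ : ¬ ∀ᶠ z in nhds p, jac F z = 0)
    (hU : U ∈ nhds p)
    (hft : ∀ φ : ℂ → C2, ∀ δ > 0, DifferentiableOn ℂ φ (ball 0 δ) →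
      (∀ ζ ∈ ball (0 : ℂ) δ, φ ζ ∈ U ∧ r (φ ζ) = 0) → ∀ ζ ∈ ball (0 : ℂ) δ, φ ζ = φ 0) :
    ∀ᶠ z in nhds p, r z = 0 → F z = F p → z = p := by
  by_contra hcon
  obtain ⟨a, ha, haP⟩ := exists_seq_forall_of_frequently (not_eventually.1 hcon)
  have har : ∀ k, r (a k) = 0 := fun k => by_contra fun h => haP k fun h' => absurd h' h
  have haF : ∀ k, F (a k) = F p := fun k => by_contra fun h => haP k fun _ h' => absurd h' h
  have hap : ∀ k, a k ≠ p := fun k h => haP k fun _ _ => h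
  obtain ⟨ρ, hρ, hρr⟩ := exists_cplx hr
  obtain ⟨ρ', hρ', hρr'⟩ := exists_cplx hr'
  obtain ⟨e, he⟩ := exists_dir hdr
  obtain ⟨e', he'⟩ := exists_dir hdr'
  have hρ0 : ρ (p, cj p) = 0 := by rw [hρr.self_of_nhds, hr0]; simp
  have hE := (fderiv_cplx_ne hρ hr.differentiableAt hρr he).1
  have hE' := (fderiv_cplx_ne hρ' hr'.differentiableAt hρr' he').1
  obtain ⟨S, hSc, hS0, hS1, hS2⟩ := impl_dir (n := 1) one_ne_zero hρ.contDiffAt hρ0 hE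
  have hSd : ∀ᶠ X in nhds ((p, cj p) : C4), DifferentiableAt ℂ S X :=
    (hSc.eventually (by simp)).mono fun X hX => hX.differentiableAt one_ne_zero
  have hFc : ContinuousAt F p := hF.self_of_nhds.continuousAt
  have hcjF : ContinuousAt (fun X : C4 => ((F X.1, cj (F (cj X.2))) : C4)) (p, cj p) := by
    refine ContinuousAt.prodMk (hFc.comp_of_eq continuousAt_fst rfl) ?_
    refine cj_cont.continuousAt.comp ?_
    exact hFc.comp_of_eq (cj_cont.continuousAt.comp continuousAt_snd) (cj_cj p)
  -- H vanishes on the complexified hypersurface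
  have hH := segre_vanish hρ hr hr0 hdr hρr (H := fun X => ρ' (F X.1, cj (F (cj X.2))))
    (by
      have c1 : ContinuousAt (fun X : C4 => X.1) (p, cj p) := continuousAt_fst
      have c2 : ContinuousAt (fun X : C4 => cj X.2) (p, cj p) :=
        cj_cont.continuousAt.comp continuousAt_snd
      have h3 := hcjF.eventually (by simpa [cj_cj] using hρ'.eventually_analyticAt)
      filter_upwards [c1.eventually hF, c2.eventually (by simpa [cj_cj] using hF), h3] with X b1 b2 b3
      have d1 : DifferentiableAt ℂ (fun X : C4 => F X.1) X :=
        DifferentiableAt.comp X b1 differentiableAt_fst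
      have d2 : DifferentiableAt ℂ (fun X : C4 => cj (F (cj X.2))) X :=
        DifferentiableAt.comp (f := fun X : C4 => X.2) (g := fun y => cj (F (cj y))) X
          (conj_hol b2) differentiableAt_snd
      exact DifferentiableAt.comp (f := fun X : C4 => ((F X.1, cj (F (cj X.2))) : C4)) X
        b3.differentiableAt (d1.prodMk d2))
    (by
      filter_upwards [hFM, hFc.eventually hρr'] with z b1 b2 b3
      simp only [cj_cj]
      rw [b2, b1 b3]; simp)
  set G : C2 → ℂ := fun x => ρ' (F x, cj (F p)) with hG
  have hGnz : ¬ ∀ᶠ x in nhds p, G x = 0 := G_nonzero hF hρ' hE' hJ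
  have hGd : ∀ᶠ x in nhds p, DifferentiableAt ℂ G x := by
    have hc : ContinuousAt (fun z => ((F z, cj (F p)) : C4)) p := hFc.prodMk continuousAt_const
    filter_upwards [hF, hc.eventually hρ'.eventually_analyticAt] with x b1 b2
    exact DifferentiableAt.comp (f := fun z => ((F z, cj (F p)) : C4)) x b2.differentiableAt
      (b1.prodMk (differentiableAt_const _))
  have he0 : e ≠ 0 := by rintro rfl; simp at he
  obtain ⟨b, cz, ct, hbt, hind⟩ := coords e he0
  -- choose δ
  have hΦ : Continuous (fun X : ℂ × ℂ => p + X.1 • b + X.2 • e) := by fun_prop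
  obtain ⟨δ, hδ, hδG⟩ := eventually_ball2 (p := (0 : ℂ))
    ((hΦ.tendsto' ((0 : ℂ), (0 : ℂ)) p (by simp)).eventually hGd)
  -- choose δ₁
  have m1c : Continuous (fun X : ℂ × C2 => ((p + X.1 • b, cj X.2) : C4)) := by
    have := cj_cont; fun_prop
  have m1P : ((p + ((0 : ℂ), p).1 • b, cj ((0 : ℂ), p).2) : C4) = (p, cj p) := by simp
  have sc : ContinuousAt (fun X : ℂ × C2 => S (p + X.1 • b, cj X.2)) (0, p) :=
    hSc.continuousAt.comp_of_eq m1c.continuousAt m1P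
  have m2c : ContinuousAt (fun X : ℂ × C2 =>
      ((p + X.1 • b + S (p + X.1 • b, cj X.2) • e, cj X.2) : C4)) (0, p) := by
    refine ContinuousAt.prodMk ?_ (cj_cont.continuousAt.comp continuousAt_snd)
    exact ContinuousAt.add (by fun_prop) (sc.smul continuousAt_const)
  have m2P : ((p + ((0 : ℂ), p).1 • b + S (p + ((0 : ℂ), p).1 • b, cj ((0 : ℂ), p).2) • e,
      cj ((0 : ℂ), p).2) : C4) = (p, cj p) := by simp [hS0]
  have q1 := (m1c.tendsto' ((0 : ℂ), p) (p, cj p) m1P).eventually hSd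
  have q2 := (m1c.tendsto' ((0 : ℂ), p) (p, cj p) m1P).eventually hS1
  have q3 := (ca_tendsto m2c m2P).eventually hH
  have q4 : ∀ᶠ X : ℂ × C2 in nhds (0, p), ‖S (p + X.1 • b, cj X.2)‖ < δ := by
    have := sc.norm.eventually_lt (g := fun _ => δ) continuousAt_const (by simpa [hS0] using hδ)
    exact this
  obtain ⟨δ1, hδ1, hQ⟩ := eventually_ball2 (q1.and (q2.and (q3.and q4)))
  set g : C2 → ℂ → ℂ := fun w ζ => S (p + ζ • b, cj w) with hg
  have hgd : ∀ w, dist w p < δ1 → DifferentiableOn ℂ (g w) (ball 0 δ1) := by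
    intro w hw ζ hζ
    have h1 := (hQ ζ (by simpa using hζ) w hw).1
    have h2 : DifferentiableAt ℂ (fun ζ : ℂ => ((p + ζ • b, cj w) : C4)) ζ := by fun_prop
    exact (DifferentiableAt.comp ζ h1 h2).differentiableWithinAt
  have hgρ : ∀ w, dist w p < δ1 → ∀ ζ : ℂ, ‖ζ‖ < δ1 → ρ (p + ζ • b + g w ζ • e, cj w) = 0 := by
    intro w hw ζ hζ
    have := (hQ ζ hζ w hw).2.1
    simpa using this
  have hgG : ∀ w, dist w p < δ1 → F w = F p → ∀ ζ : ℂ, ‖ζ‖ < δ1 → G (p + ζ • b + g w ζ • e) = 0 := by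
    intro w hw hFw ζ hζ
    have := (hQ ζ hζ w hw).2.2.1 (hgρ w hw ζ hζ)
    simpa [cj_cj, hFw, hG] using this
  have hgδ : ∀ w, dist w p < δ1 → ∀ ζ : ℂ, ‖ζ‖ < δ1 → ‖g w ζ‖ < δ :=
    fun w hw ζ hζ => (hQ ζ hζ w hw).2.2.2
  have hpp : dist p p < δ1 := by simpa using hδ1
  set γ : ℂ → C2 := fun ζ => p + ζ • b + g p ζ • e with hγ
  have hg00 : g p 0 = 0 := by simp [hg, hS0]
  have hγ0 : γ 0 = p := by simp [hγ, hg00]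
  have hγd : DifferentiableOn ℂ γ (ball 0 δ1) := by
    refine DifferentiableOn.add (by fun_prop) ((hgd p hpp).smul_const _)
  have hγc : ContinuousAt γ 0 :=
    (hγd.differentiableAt (isOpen_ball.mem_nhds (mem_ball_self hδ1))).continuousAt
  have q5 : ∀ᶠ X : ℂ × ℂ in nhds (0, 0), DifferentiableAt ℂ ρ (γ X.1, cj (γ ((starRingEnd ℂ) X.2))) := by
    have hc : ContinuousAt (fun X : ℂ × ℂ => ((γ X.1, cj (γ ((starRingEnd ℂ) X.2))) : C4)) (0, 0) := by
      refine ContinuousAt.prodMk (hγc.comp_of_eq continuousAt_fst rfl) ?_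
      refine cj_cont.continuousAt.comp ?_
      refine hγc.comp_of_eq (f := fun X : ℂ × ℂ => (starRingEnd ℂ) X.2) ?_ (by simp)
      exact (continuous_conj.comp continuous_snd).continuousAt
    have hP : ((γ ((0 : ℂ), (0 : ℂ)).1, cj (γ ((starRingEnd ℂ) ((0 : ℂ), (0 : ℂ)).2))) : C4) = (p, cj p) := by
      simp [hγ0]
    exact (ca_tendsto hc hP).eventually (hρ.eventually_analyticAt.mono fun _ h => h.differentiableAt)
  obtain ⟨δ3, hδ3, hQ5⟩ := eventually_ball2 q5
  obtain ⟨δ4, hδ4, hQ6⟩ := Metric.eventually_nhds_iff.1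
    (((ca_tendsto hγc hγ0).eventually hρr).and ((ca_tendsto hγc hγ0).eventually hU))
  obtain ⟨δ2, hδ2, h21, h23, h24, h20⟩ : ∃ δ2 > 0, δ2 ≤ δ1 ∧ δ2 ≤ δ3 ∧ δ2 ≤ δ4 ∧ δ2 ≤ δ := by
    refine ⟨min (min δ1 δ3) (min δ4 δ), by positivity, ?_, ?_, ?_, ?_⟩ <;> simp
  -- a point where G does not vanish
  have cz0 : Tendsto (fun x => cz (x - p)) (nhds p) (nhds 0) := by
    have : Continuous (fun x => cz (x - p)) := by fun_prop
    exact this.tendsto' _ _ (by simp)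
  have ct0 : Tendsto (fun x => ct (x - p)) (nhds p) (nhds 0) := by
    have : Continuous (fun x => ct (x - p)) := by fun_prop
    exact this.tendsto' _ _ (by simp)
  obtain ⟨x0, hx0, hxz, hxt⟩ := ((not_eventually.1 hGnz).and_eventually
    ((cz0.eventually (ball_mem_nhds 0 hδ2)).and (ct0.eventually (ball_mem_nhds 0 hδ)))).exists
  set ζ0 := cz (x0 - p) with hζ0
  set t0 := ct (x0 - p) with ht0
  have hdec : ∀ x, p + cz (x - p) • b + ct (x - p) • e = x := by
    intro x
    rw [add_assoc, ← hbt (x - p)]; abel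
  have hG0 : G (p + ζ0 • b + t0 • e) ≠ 0 := by rw [hdec]; exact hx0
  have hslice : ∀ ζ : ℂ, ‖ζ‖ < δ → ∀ t : ℂ, ‖t‖ < δ → DifferentiableAt ℂ G (p + ζ • b + t • e) := by
    intro ζ hζ t ht
    exact hδG ζ hζ t (by simpa using ht)
  set N : Set ℂ := ball 0 δ2 ∩ (fun ζ => G (p + ζ • b + t0 • e)) ⁻¹' {0}ᶜ with hNdef
  have hNo : IsOpen N := by
    refine ContinuousOn.isOpen_inter_preimage ?_ isOpen_ball isOpen_compl_singleton
    intro ζ hζ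
    have h1 : ‖ζ‖ < δ2 := by simpa using hζ
    have h2 : ContinuousAt (fun ζ : ℂ => p + ζ • b + t0 • e) ζ := by fun_prop
    exact (ContinuousAt.comp (g := G) (f := fun ζ : ℂ => p + ζ • b + t0 • e) (hslice ζ (h1.trans_le h20) t0
      (by simpa using hxt)).continuousAt h2).continuousWithinAt
  have hζN : ζ0 ∈ N := ⟨hxz, hG0⟩
  have hNs : ∀ ζ ∈ N, G (p + ζ • b + t0 • e) ≠ 0 := fun ζ hζ => hζ.2
  have hNδ2 : ∀ ζ ∈ N, ‖ζ‖ < δ2 := fun ζ hζ => by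
    simpa using hζ.1
  have hNδ : ∀ ζ ∈ N, ‖ζ‖ < δ := fun ζ hζ => (hNδ2 ζ hζ).trans_le h20
  have hak : ∀ᶠ k in atTop, dist (a k) p < δ1 := ha.eventually (ball_mem_nhds p hδ1)
  obtain ⟨k0, hk0⟩ := eventually_atTop.1 hak
  obtain ⟨K, hKk, hK⟩ := baire_eq (g := fun k => g (a k)) (g0 := g p) (δ := δ2) (k0 := k0)
    (fun k hk => (hgd (a k) (hk0 k hk)).mono (ball_subset_ball h21))
    ((hgd p hpp).mono (ball_subset_ball h21)) hNo
    (fun ζ hζ => by simpa using hNδ2 ζ hζ) hζN (by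
      intro ζ hζ
      have hζ2 := (hNδ2 ζ hζ).trans_le h21
      set h : ℂ → ℂ := fun t => G (p + ζ • b + t • e) with hh
      have hd : DifferentiableOn ℂ h (ball 0 δ) := by
        intro t ht
        have h2 : DifferentiableAt ℂ (fun t : ℂ => p + ζ • b + t • e) t := by fun_prop
        exact (DifferentiableAt.comp t (hslice ζ (hNδ ζ hζ) t (by simpa using ht)) h2).differentiableWithinAt
      have hiso : ∀ᶠ t in nhdsWithin (g p ζ) {g p ζ}ᶜ, h t ≠ 0 := by
        by_contra hc
        have hc' : ∃ᶠ t in nhdsWithin (g p ζ) {g p ζ}ᶜ, h t = 0 := by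
          rw [not_eventually] at hc
          exact hc.mono fun t ht => not_not.1 ht
        have := (hd.analyticOnNhd isOpen_ball).eqOn_zero_of_preconnected_of_frequently_eq_zero
          (convex_ball _ _).isPreconnected (z₀ := g p ζ)
          (by simpa using hgδ p hpp ζ hζ2) hc'
        exact hNs ζ hζ (this hxt)
      have htend : Tendsto (fun k => g (a k) ζ) atTop (nhds (g p ζ)) := by
        have c1 : ContinuousAt S (p + ζ • b, cj p) := (hQ ζ hζ2 p hpp).1.continuousAt
        have c2 : Tendsto (fun k => ((p + ζ • b, cj (a k)) : C4)) atTop (nhds (p + ζ • b, cj p)) :=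
          tendsto_const_nhds.prodMk_nhds ((cj_cont.tendsto p).comp ha)
        exact c1.tendsto.comp c2
      filter_upwards [htend.eventually (eventually_nhdsWithin_iff.1 hiso), hak] with k b1 b2
      by_contra hne
      exact b1 hne (hgG (a k) b2 (haF k) ζ hζ2))
  -- the points a_k lie on the curve
  set zk : ℕ → ℂ := fun k => cz (a k - p) with hzk
  have hzk0 : Tendsto zk atTop (nhds 0) := cz0.comp ha
  have htk0 : Tendsto (fun k => ct (a k - p)) atTop (nhds 0) := ct0.comp ha
  have huniq : ∀ᶠ k in atTop, g (a k) (zk k) = ct (a k - p) := by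
    have c2 : Tendsto (fun k => (((p + zk k • b, cj (a k)), ct (a k - p)) : C4 × ℂ)) atTop
        (nhds ((p, cj p), 0)) := by
      refine Tendsto.prodMk_nhds (Tendsto.prodMk_nhds ?_ ((cj_cont.tendsto p).comp ha)) htk0
      simpa using tendsto_const_nhds.add (hzk0.smul_const b)
    filter_upwards [c2.eventually hS2, ha.eventually hρr] with k b1 b2
    apply b1.1
    rw [har k] at b2
    simp only [Prod.smul_mk, smul_zero, Prod.mk_add_mk, add_zero]
    rw [hdec, b2]; simp
  have hzb : ∀ᶠ k in atTop, ‖zk k‖ < δ2 := by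
    filter_upwards [hzk0.eventually (ball_mem_nhds 0 hδ2)] with k hk
    simpa using hk
  have honcurve : ∀ᶠ k in atTop, a k = γ (zk k) ∧ zk k ≠ 0 := by
    filter_upwards [huniq, hzb, eventually_ge_atTop K] with k b1 b2 b3
    have h1 : g (a k) (zk k) = g p (zk k) := hK k b3 _ (by simpa using b2)
    have h2 : a k = γ (zk k) := by
      simp only [hγ]
      rw [← h1, b1, hdec]
    refine ⟨h2, fun h0 => hap k ?_⟩
    rw [h2, h0, hγ0]
  have hvan : ∀ ζ : ℂ, ‖ζ‖ < δ2 → r (γ ζ) = 0 := by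
    intro ζ hζ
    have hγcj : ∀ η ∈ ball (0 : ℂ) δ2, DifferentiableAt ℂ (fun η : ℂ => cj (γ ((starRingEnd ℂ) η))) η := by
      intro η hη
      have h1 : DifferentiableAt ℂ (fun z : C2 => γ z.1) (cj (η, 0)) := by
        have h0 : DifferentiableAt ℂ (fun z : C2 => z.1) (cj (η, 0)) := differentiableAt_fst
        refine DifferentiableAt.comp (f := fun z : C2 => z.1) (g := γ) (cj (η, 0)) ?_ h0
        refine hγd.differentiableAt (isOpen_ball.mem_nhds ?_)
        have : ‖η‖ < δ2 := by simpa using hη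
        simpa [cj] using this.trans_le h21
      have h2 := conj_hol h1
      exact DifferentiableAt.comp (f := fun η : ℂ => ((η, 0) : C2)) η h2 (by fun_prop)
    have hd : DifferentiableOn ℂ (fun η : ℂ => ρ (γ ζ, cj (γ ((starRingEnd ℂ) η)))) (ball 0 δ2) := by
      intro η hη
      have hη' : ‖η‖ < δ2 := by simpa using hη
      have h1 := hQ5 ζ (hζ.trans_le h23) η (by simpa using hη'.trans_le h23)
      exact (DifferentiableAt.comp (f := fun η : ℂ => ((γ ζ, cj (γ ((starRingEnd ℂ) η))) : C4)) η h1
        ((differentiableAt_const _).prodMk (hγcj η hη))).differentiableWithinAt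
    have htz : Tendsto (fun k => (starRingEnd ℂ) (zk k)) atTop (nhdsWithin 0 {0}ᶜ) := by
      apply tendsto_nhdsWithin_of_tendsto_nhds_of_eventually_within
      · exact (continuous_conj.tendsto' 0 0 (by simp)).comp hzk0
      · filter_upwards [honcurve] with k hk
        simpa using hk.2
    have hfr : ∃ᶠ η in nhdsWithin (0 : ℂ) {0}ᶜ, ρ (γ ζ, cj (γ ((starRingEnd ℂ) η))) = 0 := by
      refine htz.frequently (Filter.Eventually.frequently ?_)
      filter_upwards [honcurve, eventually_ge_atTop K] with k b1 b2
      rw [conj_conj, ← b1.1]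
      have h1 : g (a k) ζ = g p ζ := hK k b2 _ (by simpa using hζ)
      have h2 := hgρ (a k) (hk0 k (hKk.trans b2)) ζ (hζ.trans_le h21)
      rw [h1] at h2
      exact h2
    have hz := (hd.analyticOnNhd isOpen_ball).eqOn_zero_of_preconnected_of_frequently_eq_zero
      (convex_ball _ _).isPreconnected (mem_ball_self hδ2) hfr
    have h3 := hz (x := (starRingEnd ℂ) ζ) (by simpa using hζ)
    simp only [conj_conj, Pi.zero_apply] at h3
    have h4 := (hQ6 (y := ζ) (by simpa using hζ.trans_le h24)).1
    rw [h3] at h4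
    exact_mod_cast h4.symm
  have hconst := hft γ δ2 hδ2 (hγd.mono (ball_subset_ball h21)) (fun ζ hζ => by
    have hζ' : ‖ζ‖ < δ2 := by simpa using hζ
    exact ⟨(hQ6 (y := ζ) (by simpa using hζ'.trans_le h24)).2, hvan ζ hζ'⟩)
  obtain ⟨k, hk, hk'⟩ := (honcurve.and hzb).exists
  have := hconst (zk k) (by simpa using hk')
  rw [hγ0] at this
  exact hap k (hk.1.trans this)

/-- Haar measure on `ℂ²`. -/
def hm : MeasureTheory.Measure C2 := MeasureTheory.Measure.addHaar

instance : hm.IsAddHaarMeasure := by unfold hm; infer_instance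

theorem int_fderiv_zero {u : C2 → ℂ} (hu : ContDiff ℝ 1 u) (hc : HasCompactSupport u) (v : C2) :
    MeasureTheory.Integrable (fun z => fderiv ℝ u z v) hm ∧ ∫ z, fderiv ℝ u z v ∂hm = 0 := by
  have h1 : Continuous (fun z => fderiv ℝ u z v) :=
    (hu.continuous_fderiv one_ne_zero).clm_apply continuous_const
  have h2 : HasCompactSupport (fun z => fderiv ℝ u z v) := hc.fderiv_apply ℝ v
  have h3 := h1.integrable_of_hasCompactSupport (μ := hm) h2
  refine ⟨h3, ?_⟩
  have := integral_mul_fderiv_eq_neg_fderiv_mul_of_integrable (μ := hm) (f := fun _ => (1 : ℂ)) (g := u)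
    (v := v) (by simp) (by simpa using h3)
    (by simpa using hu.continuous.integrable_of_hasCompactSupport hc) (by simp)
    (fun x _ => hu.differentiable one_ne_zero x)
  simpa using this

theorem int_wd1 {u : C2 → ℂ} (hu : ContDiff ℝ 1 u) (hc : HasCompactSupport u) :
    MeasureTheory.Integrable (wd1 u) hm ∧ ∫ z, wd1 u z ∂hm = 0 := by
  obtain ⟨a1, a2⟩ := int_fderiv_zero hu hc ((1 : ℂ), (0 : ℂ))
  obtain ⟨b1, b2⟩ := int_fderiv_zero hu hc (Complex.I, (0 : ℂ))
  unfold wd1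
  refine ⟨(a1.sub (b1.const_mul I)).const_mul _, ?_⟩
  rw [MeasureTheory.integral_const_mul, MeasureTheory.integral_sub a1 (b1.const_mul I),
    MeasureTheory.integral_const_mul, a2, b2]
  simp

theorem int_wd2 {u : C2 → ℂ} (hu : ContDiff ℝ 1 u) (hc : HasCompactSupport u) :
    MeasureTheory.Integrable (wd2 u) hm ∧ ∫ z, wd2 u z ∂hm = 0 := by
  obtain ⟨a1, a2⟩ := int_fderiv_zero hu hc ((0 : ℂ), (1 : ℂ))
  obtain ⟨b1, b2⟩ := int_fderiv_zero hu hc ((0 : ℂ), Complex.I)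
  unfold wd2
  refine ⟨(a1.sub (b1.const_mul I)).const_mul _, ?_⟩
  rw [MeasureTheory.integral_const_mul, MeasureTheory.integral_sub a1 (b1.const_mul I),
    MeasureTheory.integral_const_mul, a2, b2]
  simp

/-- `χ(f) · conj h · a` extended by zero outside `D0`. -/
def EE (D0 : Set C2) (f : C2 → C2) (χ : C2 → ℝ) (h a : C2 → ℂ) : C2 → ℂ :=
  D0.indicator fun z => (χ (f z) : ℂ) * (starRingEnd ℂ) (h z) * a z

theorem EE_zero_near {D0 K' : Set C2} {f : C2 → C2} {χ : C2 → ℝ} {h a : C2 → ℂ}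
    (hχK : ∀ w, w ∉ K' → χ w = 0) (hK : IsCompact (D0 ∩ f ⁻¹' K'))
    {z : C2} (hz : z ∉ D0) : ∀ᶠ y in nhds z, EE D0 f χ h a y = 0 := by
  have : (D0 ∩ f ⁻¹' K')ᶜ ∈ nhds z := hK.isClosed.isOpen_compl.mem_nhds fun hh => hz hh.1
  filter_upwards [this] with y hy
  unfold EE
  by_cases hyD : y ∈ D0
  · rw [indicator_of_mem hyD, hχK _ fun hh => hy ⟨hyD, hh⟩]; simp
  · rw [indicator_of_notMem hyD]

theorem EE_eq_near {D0 : Set C2} (hD0 : IsOpen D0) {f : C2 → C2} {χ : C2 → ℝ} {h a : C2 → ℂ}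
    {z : C2} (hz : z ∈ D0) :
    EE D0 f χ h a =ᶠ[nhds z] fun z => (χ (f z) : ℂ) * (starRingEnd ℂ) (h z) * a z := by
  filter_upwards [hD0.mem_nhds hz] with y hy
  unfold EE
  rw [indicator_of_mem hy]

theorem EE_smooth {D0 K' : Set C2} (hD0 : IsOpen D0) {f : C2 → C2} (hf : DifferentiableOn ℂ f D0)
    {χ : C2 → ℝ} (hχ : ContDiff ℝ 1 χ) (hχK : ∀ w, w ∉ K' → χ w = 0)
    (hK : IsCompact (D0 ∩ f ⁻¹' K')) {h a : C2 → ℂ}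
    (hh : DifferentiableOn ℂ h D0) (ha : DifferentiableOn ℂ a D0) :
    ContDiff ℝ 1 (EE D0 f χ h a) ∧ HasCompactSupport (EE D0 f χ h a) := by
  constructor
  · rw [contDiff_iff_contDiffAt]
    intro z
    by_cases hz : z ∈ D0
    · refine ContDiffAt.congr_of_eventuallyEq ?_ (EE_eq_near hD0 hz)
      have e1 : ∀ {G : Type} [NormedAddCommGroup G] [NormedSpace ℂ G] [CompleteSpace G] {g : C2 → G},
          DifferentiableOn ℂ g D0 → ContDiffAt ℝ 1 g z := fun {G} _ _ _ {g} hg =>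
        ((hol_contDiffOn hD0 1 hg).contDiffAt (hD0.mem_nhds hz)).restrict_scalars ℝ
      have c1 : ContDiffAt ℝ 1 (fun z => (χ (f z) : ℂ)) z :=
        Complex.ofRealCLM.contDiff.contDiffAt.comp z (hχ.contDiffAt.comp z (e1 hf))
      have c2 : ContDiffAt ℝ 1 (fun z => (starRingEnd ℂ) (h z)) z :=
        Complex.conjCLE.contDiff.contDiffAt.comp z (e1 hh)
      exact (c1.mul c2).mul (e1 ha)
    · exact contDiffAt_const.congr_of_eventuallyEq (EE_zero_near hχK hK hz)
  · refine HasCompactSupport.of_support_subset_isCompact hK ?_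
    intro y hy
    unfold EE at hy
    have hyD : y ∈ D0 := by
      by_contra hc
      exact hy (indicator_of_notMem hc _)
    refine ⟨hyD, by_contra fun hc => hy ?_⟩
    rw [indicator_of_mem hyD, hχK _ hc]; simp

/-- Decomposition of a real-linear functional. -/
theorem fd_decomp (L : C2 →L[ℝ] ℝ) (ξ : C2) :
    L ξ = ξ.1.re * L (1, 0) + ξ.1.im * L (I, 0) + ξ.2.re * L (0, 1) + ξ.2.im * L (0, I) := by
  have : ξ = ξ.1.re • ((1, 0) : C2) + ξ.1.im • ((I, 0) : C2) + ξ.2.re • ((0, 1) : C2)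
      + ξ.2.im • ((0, I) : C2) := by
    ext <;> simp
  conv_lhs => rw [this]
  simp only [map_add, map_smul, smul_eq_mul]

theorem fderiv_oc {χ : C2 → ℝ} {w : C2} (hχ : DifferentiableAt ℝ χ w) (v : C2) :
    fderiv ℝ (oc χ) w v = ((fderiv ℝ χ w v : ℝ) : ℂ) := by
  have : HasFDerivAt (oc χ) (Complex.ofRealCLM.comp (fderiv ℝ χ w)) w :=
    Complex.ofRealCLM.hasFDerivAt.comp w hχ.hasFDerivAt
  rw [this.fderiv]; rfl

theorem EE_fderiv {D0 : Set C2} (hD0 : IsOpen D0) {f : C2 → C2} (hf : DifferentiableOn ℂ f D0)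
    {χ : C2 → ℝ} (hχ : ContDiff ℝ 1 χ) {h a : C2 → ℂ}
    (hh : DifferentiableOn ℂ h D0) (ha : DifferentiableOn ℂ a D0) {z : C2} (hz : z ∈ D0) (v : C2) :
    fderiv ℝ (EE D0 f χ h a) z v =
      ((fderiv ℝ χ (f z) (fderiv ℂ f z v) : ℝ) : ℂ) * (starRingEnd ℂ) (h z) * a z
      + (χ (f z) : ℂ) * (starRingEnd ℂ) (fderiv ℂ h z v) * a z
      + (χ (f z) : ℂ) * (starRingEnd ℂ) (h z) * fderiv ℂ a z v := by
  rw [(EE_eq_near hD0 hz).fderiv_eq]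
  have hn := hD0.mem_nhds hz
  have d1 := ((hf.differentiableAt hn).hasFDerivAt).restrictScalars ℝ
  have d2 := ((hh.differentiableAt hn).hasFDerivAt).restrictScalars ℝ
  have d3 := ((ha.differentiableAt hn).hasFDerivAt).restrictScalars ℝ
  have c1 := Complex.ofRealCLM.hasFDerivAt.comp z
    ((hχ.differentiable one_ne_zero (f z)).hasFDerivAt.comp z d1)
  have c2 := Complex.conjCLE.toContinuousLinearMap.hasFDerivAt.comp z d2
  have c3 := (c1.mul c2).mul d3
  have : fderiv ℝ (fun z => (χ (f z) : ℂ) * (starRingEnd ℂ) (h z) * a z) z = _ := c3.fderiv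
  rw [this]
  simp
  ring

theorem EE_wd1 {D0 : Set C2} (hD0 : IsOpen D0) {f : C2 → C2} (hf : DifferentiableOn ℂ f D0)
    {χ : C2 → ℝ} (hχ : ContDiff ℝ 1 χ) {h a : C2 → ℂ}
    (hh : DifferentiableOn ℂ h D0) (ha : DifferentiableOn ℂ a D0) {z : C2} (hz : z ∈ D0) :
    wd1 (EE D0 f χ h a) z =
      (wd1 (oc χ) (f z) * (fderiv ℂ f z (1, 0)).1 + wd2 (oc χ) (f z) * (fderiv ℂ f z (1, 0)).2)
        * (starRingEnd ℂ) (h z) * a z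
      + (χ (f z) : ℂ) * (starRingEnd ℂ) (h z) * fderiv ℂ a z (1, 0) := by
  have hI : ((I, 0) : C2) = I • ((1, 0) : C2) := by ext <;> simp
  unfold wd1 wd2
  rw [EE_fderiv hD0 hf hχ hh ha hz, EE_fderiv hD0 hf hχ hh ha hz]
  simp only [fderiv_oc (hχ.differentiable one_ne_zero _)]
  rw [fd_decomp (fderiv ℝ χ (f z)) (fderiv ℂ f z (1, 0)), fd_decomp (fderiv ℝ χ (f z)) (fderiv ℂ f z (I, 0))]
  rw [hI]
  simp only [map_smul, Prod.smul_fst, Prod.smul_snd, smul_eq_mul]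
  rw [← hI]
  generalize fderiv ℂ f z (1, 0) = ξ
  obtain ⟨⟨x1, y1⟩, ⟨x2, y2⟩⟩ := ξ
  have e1 : (⟨x1, y1⟩ : ℂ) = x1 + y1 * I := by apply Complex.ext <;> simp
  have e2 : (⟨x2, y2⟩ : ℂ) = x2 + y2 * I := by apply Complex.ext <;> simp
  simp only [Complex.mul_re, Complex.mul_im, Complex.I_re, Complex.I_im]
  rw [e1, e2]
  push_cast
  simp only [map_mul, conj_I]
  ring_nf
  simp only [I_sq]
  ring

theorem EE_wd2 {D0 : Set C2} (hD0 : IsOpen D0) {f : C2 → C2} (hf : DifferentiableOn ℂ f D0)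
    {χ : C2 → ℝ} (hχ : ContDiff ℝ 1 χ) {h a : C2 → ℂ}
    (hh : DifferentiableOn ℂ h D0) (ha : DifferentiableOn ℂ a D0) {z : C2} (hz : z ∈ D0) :
    wd2 (EE D0 f χ h a) z =
      (wd1 (oc χ) (f z) * (fderiv ℂ f z (0, 1)).1 + wd2 (oc χ) (f z) * (fderiv ℂ f z (0, 1)).2)
        * (starRingEnd ℂ) (h z) * a z
      + (χ (f z) : ℂ) * (starRingEnd ℂ) (h z) * fderiv ℂ a z (0, 1) := by
  have hI : ((0, I) : C2) = I • ((0, 1) : C2) := by ext <;> simp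
  unfold wd1 wd2
  rw [EE_fderiv hD0 hf hχ hh ha hz, EE_fderiv hD0 hf hχ hh ha hz]
  simp only [fderiv_oc (hχ.differentiable one_ne_zero _)]
  rw [fd_decomp (fderiv ℝ χ (f z)) (fderiv ℂ f z (0, 1)), fd_decomp (fderiv ℝ χ (f z)) (fderiv ℂ f z (0, I))]
  rw [hI]
  simp only [map_smul, Prod.smul_fst, Prod.smul_snd, smul_eq_mul]
  rw [← hI]
  generalize fderiv ℂ f z (0, 1) = ξ
  obtain ⟨⟨x1, y1⟩, ⟨x2, y2⟩⟩ := ξ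
  have e1 : (⟨x1, y1⟩ : ℂ) = x1 + y1 * I := by apply Complex.ext <;> simp
  have e2 : (⟨x2, y2⟩ : ℂ) = x2 + y2 * I := by apply Complex.ext <;> simp
  simp only [Complex.mul_re, Complex.mul_im, Complex.I_re, Complex.I_im]
  rw [e1, e2]
  push_cast
  simp only [map_mul, conj_I]
  ring_nf
  simp only [I_sq]
  ring


theorem snd_symm {U : Set C2} (hU : IsOpen U) {g : C2 → ℂ} (hg : DifferentiableOn ℂ g U) {z : C2}
    (hz : z ∈ U) (v w : C2) :
    fderiv ℂ (fun y => fderiv ℂ g y v) z w = fderiv ℂ (fun y => fderiv ℂ g y w) z v := by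
  have hc : ContDiffAt ℂ 2 g z := (hol_contDiffOn hU 2 hg).contDiffAt (hU.mem_nhds hz)
  have hs := hc.isSymmSndFDerivAt (by simp)
  have hd : DifferentiableAt ℂ (fderiv ℂ g) z :=
    (hc.fderiv_right (m := 1) (by norm_num)).differentiableAt one_ne_zero
  have e : ∀ v w : C2, fderiv ℂ (fun y => fderiv ℂ g y v) z w = fderiv ℂ (fderiv ℂ g) z w v := by
    intro v w
    have := (hd.hasFDerivAt.clm_apply (hasFDerivAt_const v z)).fderiv
    rw [this]; simp
  rw [e, e]
  exact hs w v

theorem EE_wd_out {D0 K' : Set C2} {f : C2 → C2} {χ : C2 → ℝ} {h a : C2 → ℂ}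
    (hχK : ∀ w, w ∉ K' → χ w = 0) (hK : IsCompact (D0 ∩ f ⁻¹' K'))
    {z : C2} (hz : z ∉ D0) : wd1 (EE D0 f χ h a) z = 0 ∧ wd2 (EE D0 f χ h a) z = 0 := by
  have h0 : EE D0 f χ h a =ᶠ[nhds z] fun _ => 0 := EE_zero_near hχK hK hz
  have := h0.fderiv_eq (𝕜 := ℝ)
  unfold wd1 wd2
  rw [this]; simp

theorem int_comb {A B C E : C2 → ℂ}
    (hA : MeasureTheory.Integrable A hm ∧ ∫ z, A z ∂hm = 0)
    (hB : MeasureTheory.Integrable B hm ∧ ∫ z, B z ∂hm = 0)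
    (hC : MeasureTheory.Integrable C hm ∧ ∫ z, C z ∂hm = 0)
    (hE : MeasureTheory.Integrable E hm ∧ ∫ z, E z ∂hm = 0) :
    ∫ z, (A z - B z - C z + E z) ∂hm = 0 := by
  have h1 : MeasureTheory.Integrable (fun z => A z - B z) hm := hA.1.sub hB.1
  have h2 : MeasureTheory.Integrable (fun z => A z - B z - C z) hm := h1.sub hC.1
  rw [MeasureTheory.integral_add h2 hE.1, MeasureTheory.integral_sub h1 hC.1,
    MeasureTheory.integral_sub hA.1 hB.1, hA.2, hB.2, hC.2, hE.2]
  simp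

theorem degenerate_const {D0 K' : Set C2} (hD0 : IsOpen D0) {f : C2 → C2} (hf : DifferentiableOn ℂ f D0)
    {χ : C2 → ℝ} (hχ : ContDiff ℝ 1 χ) (hχK : ∀ w, w ∉ K' → χ w = 0) (hχ0 : ∀ w, 0 ≤ χ w)
    (hK : IsCompact (D0 ∩ f ⁻¹' K')) {g : C2 → ℂ} (hg : DifferentiableOn ℂ g D0)
    (hdeg : ∀ z ∈ D0, ∀ P1 P2 : ℂ,
      (P1 * (fderiv ℂ f z (0, 1)).1 + P2 * (fderiv ℂ f z (0, 1)).2) * fderiv ℂ g z (1, 0) =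
      (P1 * (fderiv ℂ f z (1, 0)).1 + P2 * (fderiv ℂ f z (1, 0)).2) * fderiv ℂ g z (0, 1))
    {z : C2} (hz : z ∈ D0) (hχz : χ (f z) ≠ 0) : fderiv ℂ g z (1, 0) = 0 ∧ fderiv ℂ g z (0, 1) = 0 := by
  set a1 : C2 → ℂ := fun y => fderiv ℂ g y (1, 0) with ha1
  set a2 : C2 → ℂ := fun y => fderiv ℂ g y (0, 1) with ha2
  have h1 : DifferentiableOn ℂ a1 D0 := fderiv_dir_hol hD0 hg _
  have h2 : DifferentiableOn ℂ a2 D0 := fderiv_dir_hol hD0 hg _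
  have hp1 : DifferentiableOn ℂ (fun y : C2 => y.1) D0 := differentiableOn_fst
  have hp2 : DifferentiableOn ℂ (fun y : C2 => y.2) D0 := differentiableOn_snd
  have k1 : DifferentiableOn ℂ (fun y : C2 => y.2 * a1 y) D0 := hp2.mul h1
  have k2 : DifferentiableOn ℂ (fun y : C2 => y.1 * a1 y) D0 := hp1.mul h1
  have k3 : DifferentiableOn ℂ (fun y : C2 => y.2 * a2 y) D0 := hp2.mul h2
  have k4 : DifferentiableOn ℂ (fun y : C2 => y.1 * a2 y) D0 := hp1.mul h2
  have s1 := EE_smooth hD0 hf hχ hχK hK h1 k1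
  have s2 := EE_smooth hD0 hf hχ hχK hK h2 k2
  have s3 := EE_smooth hD0 hf hχ hχK hK h1 k3
  have s4 := EE_smooth hD0 hf hχ hχK hK h2 k4
  obtain ⟨i1, j1⟩ := int_wd2 s1.1 s1.2
  obtain ⟨i2, j2⟩ := int_wd2 s2.1 s2.2
  obtain ⟨i3, j3⟩ := int_wd1 s3.1 s3.2
  obtain ⟨i4, j4⟩ := int_wd1 s4.1 s4.2
  have q1 := EE_smooth hD0 hf hχ hχK hK h1 h1
  have q2 := EE_smooth hD0 hf hχ hχK hK h2 h2
  have hmul1 : ∀ (b : C2 → ℂ), DifferentiableOn ℂ b D0 → ∀ y ∈ D0, ∀ v,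
      fderiv ℂ (fun y : C2 => y.1 * b y) y v = y.1 * fderiv ℂ b y v + v.1 * b y := by
    intro b hb y hy v
    have := ((hasFDerivAt_fst (𝕜 := ℂ) (p := y)).mul
      (hb.differentiableAt (hD0.mem_nhds hy)).hasFDerivAt).fderiv
    have h' : fderiv ℂ (fun y : C2 => y.1 * b y) y = _ := this
    rw [h']; simp [mul_comm]
  have hmul2 : ∀ (b : C2 → ℂ), DifferentiableOn ℂ b D0 → ∀ y ∈ D0, ∀ v,
      fderiv ℂ (fun y : C2 => y.2 * b y) y v = y.2 * fderiv ℂ b y v + v.2 * b y := by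
    intro b hb y hy v
    have := ((hasFDerivAt_snd (𝕜 := ℂ) (p := y)).mul
      (hb.differentiableAt (hD0.mem_nhds hy)).hasFDerivAt).fderiv
    have h' : fderiv ℂ (fun y : C2 => y.2 * b y) y = _ := this
    rw [h']; simp [mul_comm]
  have hpt : ∀ y, EE D0 f χ a1 a1 y + EE D0 f χ a2 a2 y =
      wd2 (EE D0 f χ a1 fun y => y.2 * a1 y) y - wd2 (EE D0 f χ a2 fun y => y.1 * a1 y) y
      - wd1 (EE D0 f χ a1 fun y => y.2 * a2 y) y + wd1 (EE D0 f χ a2 fun y => y.1 * a2 y) y := by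
    intro y
    by_cases hy : y ∈ D0
    · rw [EE_wd2 hD0 hf hχ h1 k1 hy, EE_wd2 hD0 hf hχ h2 k2 hy, EE_wd1 hD0 hf hχ h1 k3 hy,
        EE_wd1 hD0 hf hχ h2 k4 hy, hmul1 a1 h1 y hy, hmul1 a2 h2 y hy, hmul2 a1 h1 y hy,
        hmul2 a2 h2 y hy]
      have hsym : fderiv ℂ a1 y (0, 1) = fderiv ℂ a2 y (1, 0) := snd_symm hD0 hg hy _ _
      rw [hsym]
      have hd := hdeg y hy (wd1 (oc χ) (f y)) (wd2 (oc χ) (f y))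
      rw [(EE_eq_near hD0 hy).self_of_nhds, (EE_eq_near hD0 hy).self_of_nhds]
      change _ * a1 y = _ * a2 y at hd
      linear_combination (-(starRingEnd ℂ) (a1 y) * y.2 + (starRingEnd ℂ) (a2 y) * y.1) * hd
    · rw [(EE_wd_out hχK hK hy).1, (EE_wd_out hχK hK hy).1, (EE_wd_out hχK hK hy).2,
        (EE_wd_out hχK hK hy).2, (EE_zero_near hχK hK hy).self_of_nhds,
        (EE_zero_near hχK hK hy).self_of_nhds]
      simp
  have hintg : ∫ y, (EE D0 f χ a1 a1 y + EE D0 f χ a2 a2 y) ∂hm = 0 := by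
    simp_rw [hpt]
    exact int_comb ⟨i1, j1⟩ ⟨i2, j2⟩ ⟨i3, j3⟩ ⟨i4, j4⟩
  set Q : C2 → ℝ := fun y => (EE D0 f χ a1 a1 y + EE D0 f χ a2 a2 y).re with hQ
  have hQv : ∀ y ∈ D0, Q y = χ (f y) * (normSq (a1 y) + normSq (a2 y)) := by
    intro y hy
    simp only [hQ]
    rw [(EE_eq_near hD0 hy).self_of_nhds, (EE_eq_near hD0 hy).self_of_nhds]
    dsimp only
    rw [mul_assoc, mul_assoc, ← normSq_eq_conj_mul_self, ← normSq_eq_conj_mul_self, ← ofReal_mul,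
      ← ofReal_mul, ← ofReal_add, ofReal_re]
    ring
  have hQ0 : 0 ≤ Q := by
    intro y
    by_cases hy : y ∈ D0
    · rw [hQv y hy]
      exact mul_nonneg (hχ0 _) (add_nonneg (normSq_nonneg _) (normSq_nonneg _))
    · simp only [hQ]
      rw [(EE_zero_near hχK hK hy).self_of_nhds, (EE_zero_near hχK hK hy).self_of_nhds]
      simp
  have hcc : Continuous (fun y => EE D0 f χ a1 a1 y + EE D0 f χ a2 a2 y) :=
    q1.1.continuous.add q2.1.continuous
  have hcs : HasCompactSupport (fun y => EE D0 f χ a1 a1 y + EE D0 f χ a2 a2 y) := q1.2.add q2.2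
  have hQi : ∫ y, Q y ∂hm = 0 := by
    have := Complex.reCLM.integral_comp_comm (hcc.integrable_of_hasCompactSupport (μ := hm) hcs)
    rw [hintg] at this
    exact this.trans (by simp)
  have hQz : Q z = 0 := by
    by_contra hne
    have := Continuous.integral_pos_of_hasCompactSupport_nonneg_nonzero (μ := hm)
      (Complex.continuous_re.comp hcc) (hcs.comp_left (g := Complex.re) rfl) hQ0 hne
    exact absurd hQi this.ne'
  rw [hQv z hz] at hQz
  have h3 := (mul_eq_zero.1 hQz).resolve_left hχz
  have h4 := normSq_nonneg (a1 z)
  have h5 := normSq_nonneg (a2 z)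
  exact ⟨normSq_eq_zero.1 (by linarith), normSq_eq_zero.1 (by linarith)⟩


theorem fderiv_fst_hol {f : C2 → C2} {z : C2} (hf : DifferentiableAt ℂ f z) (v : C2) :
    fderiv ℂ (fun y => (f y).1) z v = (fderiv ℂ f z v).1 := by
  rw [hf.hasFDerivAt.fst.fderiv]; rfl

theorem fderiv_snd_hol {f : C2 → C2} {z : C2} (hf : DifferentiableAt ℂ f z) (v : C2) :
    fderiv ℂ (fun y => (f y).2) z v = (fderiv ℂ f z v).2 := by
  rw [hf.hasFDerivAt.snd.fderiv]; rfl

theorem clm_zero {L : C2 →L[ℂ] ℂ} (h1 : L (1, 0) = 0) (h2 : L (0, 1) = 0) : L = 0 := by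
  ext
  · simpa using h1
  · simpa using h2

theorem const_of_deriv_zero_near {D : Set C2} (hD : IsOpen D) (hDc : IsPreconnected D) {g : C2 → ℂ}
    (hg : DifferentiableOn ℂ g D) {z0 : C2} (hz0 : z0 ∈ D)
    (h : ∀ᶠ z in nhds z0, fderiv ℂ g z (1, 0) = 0 ∧ fderiv ℂ g z (0, 1) = 0) :
    ∀ z ∈ D, g z = g z0 := by
  have h1 : ∀ᶠ z in nhds z0, g z - g z0 = 0 := by
    obtain ⟨ε, hε, hb⟩ := Metric.eventually_nhds_iff_ball.1 (h.and (hD.mem_nhds hz0))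
    filter_upwards [ball_mem_nhds z0 hε] with z hz
    have := (convex_ball z0 ε).is_const_of_fderivWithin_eq_zero (𝕜 := ℂ) (f := g)
      (fun y hy => (hg y (hb y hy).2).mono fun x hx => (hb x hx).2)
      (fun y hy => by
        rw [fderivWithin_of_isOpen isOpen_ball hy]
        exact clm_zero (hb y hy).1.1 (hb y hy).1.2) hz (mem_ball_self hε)
    rw [this, sub_self]
  intro z hz
  exact sub_eq_zero.1 (hol_zero_conn hD hDc (f := fun z => g z - g z0)
    (hg.sub (differentiableOn_const _)) hz0 h1 z hz)

theorem jac_not_zero {D D' : Set C2} {f : C2 → C2} (hD : IsOpen D) (hDc : IsConnected D)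
    (hD' : IsOpen D') (hf : DifferentiableOn ℂ f D) (hfm : MapsTo f D D')
    (hfp : ∀ K : Set C2, K ⊆ D' → IsCompact K → IsCompact (D ∩ f ⁻¹' K)) :
    ¬ ∀ z ∈ D, jac f z = 0 := by
  intro hJ
  obtain ⟨z0, hz0⟩ := hDc.nonempty
  obtain ⟨ε, hε, hb⟩ := Metric.nhds_basis_closedBall.mem_iff.1 (hD'.mem_nhds (hfm hz0))
  let χ : ContDiffBump (f z0) := ⟨ε / 2, ε, by positivity, by linarith⟩
  have hχ : ContDiff ℝ 1 χ := χ.contDiff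
  have hχK : ∀ w, w ∉ closedBall (f z0) ε → χ w = 0 := by
    intro w hw
    apply χ.zero_of_le_dist
    have : ¬ dist w (f z0) ≤ ε := hw
    exact (not_le.1 this).le
  have hK := hfp _ hb (isCompact_closedBall _ _)
  have hfc : ContinuousAt f z0 := (hf.differentiableAt (hD.mem_nhds hz0)).continuousAt
  have hne : ∀ᶠ z in nhds z0, z ∈ D ∧ χ (f z) ≠ 0 := by
    filter_upwards [hD.mem_nhds hz0, hfc.eventually (ball_mem_nhds (f z0) hε)] with z h1 h2
    exact ⟨h1, (χ.pos_of_mem_ball h2).ne'⟩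
  have hd : ∀ z ∈ D, DifferentiableAt ℂ f z := fun z hz => hf.differentiableAt (hD.mem_nhds hz)
  have hf1 : DifferentiableOn ℂ (fun y => (f y).1) D := fun z hz => (hd z hz).fst.differentiableWithinAt
  have hf2 : DifferentiableOn ℂ (fun y => (f y).2) D := fun z hz => (hd z hz).snd.differentiableWithinAt
  have c1 := const_of_deriv_zero_near hD hDc.isPreconnected hf1 hz0 (by
    filter_upwards [hne] with z hz
    refine degenerate_const hD hf hχ hχK (fun w => χ.nonneg) hK hf1 ?_ hz.1 hz.2
    intro y hy P1 P2
    rw [fderiv_fst_hol (hd y hy), fderiv_fst_hol (hd y hy)]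
    have := hJ y hy
    unfold jac at this
    linear_combination P2 * this)
  have c2 := const_of_deriv_zero_near hD hDc.isPreconnected hf2 hz0 (by
    filter_upwards [hne] with z hz
    refine degenerate_const hD hf hχ hχK (fun w => χ.nonneg) hK hf2 ?_ hz.1 hz.2
    intro y hy P1 P2
    rw [fderiv_snd_hol (hd y hy), fderiv_snd_hol (hd y hy)]
    have := hJ y hy
    unfold jac at this
    linear_combination - P1 * this)
  have hcomp := hfp {f z0} (by simpa using hfm hz0) isCompact_singleton
  have hDD : D ∩ f ⁻¹' {f z0} = D := by
    ext z
    exact ⟨fun h => h.1, fun h => ⟨h, Prod.ext (c1 z h) (c2 z h)⟩⟩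
  rw [hDD] at hcomp
  have hclopen : IsClopen D := ⟨hcomp.isClosed, hD⟩
  have := hclopen.eq_univ ⟨z0, hz0⟩
  rw [this] at hcomp
  exact noncompact_univ C2 hcomp

theorem inv_int {D0 K' : Set C2} (hD0 : IsOpen D0) {f : C2 → C2} (hf : DifferentiableOn ℂ f D0)
    {χ : C2 → ℝ} (hχ : ContDiff ℝ 1 χ) (hχK : ∀ w, w ∉ K' → χ w = 0)
    (hK : IsCompact (D0 ∩ f ⁻¹' K')) (v : C2) :
    MeasureTheory.Integrable (D0.indicator fun z => fderiv ℝ χ (f z) v * normSq (jac f z)) hm ∧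
    ∫ z, (D0.indicator fun z => fderiv ℝ χ (f z) v * normSq (jac f z)) z ∂hm = 0 := by
  have hd : ∀ z ∈ D0, DifferentiableAt ℂ f z := fun z hz => hf.differentiableAt (hD0.mem_nhds hz)
  have hf1 : DifferentiableOn ℂ (fun y => (f y).1) D0 := fun z hz => (hd z hz).fst.differentiableWithinAt
  have hf2 : DifferentiableOn ℂ (fun y => (f y).2) D0 := fun z hz => (hd z hz).snd.differentiableWithinAt
  have hJ := jac_hol hD0 hf
  have hp := fun e => fderiv_dir_hol hD0 hf1 e
  have hq := fun e => fderiv_dir_hol hD0 hf2 e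
  set a1 : C2 → ℂ := fun z => fderiv ℂ (fun y => (f y).2) z (0, 1) * v.1
    - fderiv ℂ (fun y => (f y).1) z (0, 1) * v.2 with ha1
  set a2 : C2 → ℂ := fun z => fderiv ℂ (fun y => (f y).1) z (1, 0) * v.2
    - fderiv ℂ (fun y => (f y).2) z (1, 0) * v.1 with ha2
  have h1 : DifferentiableOn ℂ a1 D0 := ((hq _).mul_const _).sub ((hp _).mul_const _)
  have h2 : DifferentiableOn ℂ a2 D0 := ((hp _).mul_const _).sub ((hq _).mul_const _)
  have s1 := EE_smooth hD0 hf hχ hχK hK hJ h1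
  have s2 := EE_smooth hD0 hf hχ hχK hK hJ h2
  have hpt : ∀ z, (D0.indicator fun z => fderiv ℝ χ (f z) v * normSq (jac f z)) z =
      2 * (wd1 (EE D0 f χ (jac f) a1) z + wd2 (EE D0 f χ (jac f) a2) z).re := by
    intro z
    by_cases hz : z ∈ D0
    · have hn := hD0.mem_nhds hz
      rw [indicator_of_mem hz, EE_wd1 hD0 hf hχ hJ h1 hz, EE_wd2 hD0 hf hχ hJ h2 hz]
      have e1 : fderiv ℂ a1 z (1, 0) = fderiv ℂ (fun z => fderiv ℂ (fun y => (f y).2) z (0, 1)) z (1, 0) * v.1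
          - fderiv ℂ (fun z => fderiv ℂ (fun y => (f y).1) z (0, 1)) z (1, 0) * v.2 := by
        rw [((((hq (0, 1)).differentiableAt hn).hasFDerivAt.mul_const v.1).fun_sub
          (((hp (0, 1)).differentiableAt hn).hasFDerivAt.mul_const v.2)).fderiv]
        simp [mul_comm]
      have e2 : fderiv ℂ a2 z (0, 1) = fderiv ℂ (fun z => fderiv ℂ (fun y => (f y).1) z (1, 0)) z (0, 1) * v.2
          - fderiv ℂ (fun z => fderiv ℂ (fun y => (f y).2) z (1, 0)) z (0, 1) * v.1 := by
        rw [((((hp (1, 0)).differentiableAt hn).hasFDerivAt.mul_const v.2).fun_sub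
          (((hq (1, 0)).differentiableAt hn).hasFDerivAt.mul_const v.1)).fderiv]
        simp [mul_comm]
      rw [e1, e2, snd_symm hD0 hf1 hz (0, 1) (1, 0), snd_symm hD0 hf2 hz (0, 1) (1, 0)]
      have e3 : ∀ v, fderiv ℂ (fun y => (f y).1) z v = (fderiv ℂ f z v).1 := fderiv_fst_hol (hd z hz)
      have e4 : ∀ v, fderiv ℂ (fun y => (f y).2) z v = (fderiv ℂ f z v).2 := fderiv_snd_hol (hd z hz)
      have e5 : ((normSq (jac f z) : ℝ) : ℂ) = (starRingEnd ℂ) (jac f z) * jac f z := normSq_eq_conj_mul_self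
      have e6 : ∀ P1 P2 X Y : ℂ,
          (P1 * (fderiv ℂ f z (1, 0)).1 + P2 * (fderiv ℂ f z (1, 0)).2) * (starRingEnd ℂ) (jac f z) * a1 z
          + (χ (f z) : ℂ) * (starRingEnd ℂ) (jac f z) * (Y * v.1 - X * v.2)
          + ((P1 * (fderiv ℂ f z (0, 1)).1 + P2 * (fderiv ℂ f z (0, 1)).2) * (starRingEnd ℂ) (jac f z) * a2 z
          + (χ (f z) : ℂ) * (starRingEnd ℂ) (jac f z) * (X * v.2 - Y * v.1))
          = ((normSq (jac f z) : ℝ) : ℂ) * (P1 * v.1 + P2 * v.2) := by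
        intro P1 P2 X Y
        rw [e5]
        simp only [ha1, ha2, e3, e4]
        generalize (starRingEnd ℂ) (jac f z) = c
        unfold jac
        ring
      rw [e6, re_ofReal_mul]
      unfold wd1 wd2
      simp only [fderiv_oc (hχ.differentiable one_ne_zero _)]
      rw [fd_decomp (fderiv ℝ χ (f z)) v]
      simp
      ring
    · rw [indicator_of_notMem hz, (EE_wd_out hχK hK hz).1, (EE_wd_out hχK hK hz).2]; simp
  obtain ⟨i1, j1⟩ := int_wd1 s1.1 s1.2
  obtain ⟨i2, j2⟩ := int_wd2 s2.1 s2.2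
  have i3 : MeasureTheory.Integrable (fun z => wd1 (EE D0 f χ (jac f) a1) z + wd2 (EE D0 f χ (jac f) a2) z) hm :=
    i1.add i2
  have i4 : MeasureTheory.Integrable
      (fun z => (wd1 (EE D0 f χ (jac f) a1) z + wd2 (EE D0 f χ (jac f) a2) z).re) hm := i3.re
  have hfun := funext hpt
  constructor
  · rw [hfun]; exact i4.const_mul 2
  · simp_rw [hpt]
    rw [MeasureTheory.integral_const_mul]
    have := Complex.reCLM.integral_comp_comm i3
    rw [MeasureTheory.integral_add i1 i2, j1, j2] at this
    have h' : ∫ z, (wd1 (EE D0 f χ (jac f) a1) z + wd2 (EE D0 f χ (jac f) a2) z).re ∂hm = 0 :=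
      this.trans (by simp)
    rw [h', mul_zero]

/-- The mass of `φ(f - w0 - t v) |J|²` does not depend on `t ∈ [0,1]`. -/
theorem mass_const {D0 : Set C2} (hD0 : IsOpen D0) {f : C2 → C2} (hf : DifferentiableOn ℂ f D0)
    {φ : C2 → ℝ} (hφ : ContDiff ℝ 1 φ) {ρ : ℝ} (hφ0 : ∀ w, ρ ≤ ‖w‖ → φ w = 0)
    {w0 v : C2} (hv : ‖v‖ ≤ ρ) (hK : IsCompact (D0 ∩ f ⁻¹' (closedBall w0 (4 * ρ)))) :
    ∫ z, D0.indicator (fun z => φ (f z - w0 - (1 : ℝ) • v) * normSq (jac f z)) z ∂hm =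
    ∫ z, D0.indicator (fun z => φ (f z - w0 - (0 : ℝ) • v) * normSq (jac f z)) z ∂hm := by
  set K : Set C2 := D0 ∩ f ⁻¹' (closedBall w0 (4 * ρ)) with hKdef
  have hJ := jac_hol hD0 hf
  have hρ : 0 ≤ ρ := (norm_nonneg v).trans hv
  let ψ : ℝ → C2 → ℝ := fun t w => φ (w - w0 - t • v)
  have hψ : ∀ t, ContDiff ℝ 1 (ψ t) := fun t => hφ.comp (by fun_prop)
  have hψd : ∀ t w e, fderiv ℝ (ψ t) w e = fderiv ℝ φ (w - w0 - t • v) e := by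
    intro t w e
    have h1 : HasFDerivAt (fun w : C2 => w - w0 - t • v) (ContinuousLinearMap.id ℝ C2) w :=
      ((hasFDerivAt_id w).sub_const w0).sub_const (t • v)
    have := ((hφ.differentiable one_ne_zero (w - w0 - t • v)).hasFDerivAt.comp w h1).fderiv
    change fderiv ℝ (φ ∘ fun w : C2 => w - w0 - t • v) w e = _
    rw [this]; simp
  have hout : ∀ t : ℝ, |t| ≤ 3 → ∀ w, w ∉ closedBall w0 (4 * ρ) → ρ ≤ ‖w - w0 - t • v‖ := by
    intro t ht w hw
    have h1 : 4 * ρ < ‖w - w0‖ := by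
      rw [mem_closedBall, dist_eq_norm, not_le] at hw; exact hw
    have h2 : ‖t • v‖ ≤ 3 * ρ := by
      rw [norm_smul, Real.norm_eq_abs]
      exact mul_le_mul ht hv (norm_nonneg _) (by norm_num)
    have h3 := norm_sub_norm_le (w - w0) (t • v)
    linarith
  have hψK : ∀ t : ℝ, |t| ≤ 3 → ∀ w, w ∉ closedBall w0 (4 * ρ) → ψ t w = 0 :=
    fun t ht w hw => hφ0 _ (hout t ht w hw)
  let G : ℝ → C2 → ℝ := fun t => D0.indicator (fun z => ψ t (f z) * normSq (jac f z))
  let G' : ℝ → C2 → ℝ := fun t => D0.indicator (fun z => fderiv ℝ (ψ t) (f z) (-v) * normSq (jac f z))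
  have hGc : ∀ t : ℝ, |t| ≤ 3 → MeasureTheory.Integrable (G t) hm := by
    intro t ht
    have h1 := EE_smooth hD0 hf (hψ t) (hψK t ht) hK hJ hJ
    have h2 := h1.1.continuous.integrable_of_hasCompactSupport (μ := hm) h1.2
    have h3 : G t = fun z => (EE D0 f (ψ t) (jac f) (jac f) z).re := by
      funext z
      by_cases hz : z ∈ D0
      · simp only [G, EE, indicator_of_mem hz]
        rw [mul_assoc, ← normSq_eq_conj_mul_self, ← ofReal_mul, ofReal_re]
      · simp only [G, EE, indicator_of_notMem hz, zero_re]
    rw [h3]; exact h2.re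
  obtain ⟨C, hC⟩ : ∃ C, ∀ w, ‖fderiv ℝ φ w (-v)‖ ≤ C := by
    have h1 : Continuous fun w => fderiv ℝ φ w (-v) :=
      (hφ.continuous_fderiv one_ne_zero).clm_apply continuous_const
    have h2 : HasCompactSupport φ := by
      refine HasCompactSupport.of_support_subset_isCompact (isCompact_closedBall 0 ρ) fun w hw => ?_
      rw [mem_closedBall_zero_iff]
      by_contra hc
      exact hw (hφ0 w (not_le.1 hc).le)
    exact (h2.fderiv_apply ℝ (-v)).exists_bound_of_continuous h1
  have hbound : MeasureTheory.Integrable (K.indicator fun z => C * normSq (jac f z)) hm := by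
    rw [MeasureTheory.integrable_indicator_iff hK.measurableSet]
    refine ContinuousOn.integrableOn_compact hK ?_
    refine continuousOn_const.mul (continuous_normSq.comp_continuousOn (hJ.continuousOn.mono ?_))
    exact inter_subset_left
  have hder : ∀ t0 ∈ Icc (0 : ℝ) 1, HasDerivAt (fun t => ∫ z, G t z ∂hm) 0 t0 := by
    intro t0 ht0
    have hI : ∀ t ∈ ball t0 1, |t| ≤ 3 := by
      intro t ht
      have h1 : |t - t0| < 1 := by simpa [Real.dist_eq] using ht
      rw [abs_lt] at h1
      rw [abs_le]
      constructor <;> linarith [ht0.1, ht0.2]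
    have ht03 := hI t0 (mem_ball_self one_pos)
    have hin := inv_int hD0 hf (hψ t0) (hψK t0 ht03) hK (-v)
    have := hasDerivAt_integral_of_dominated_loc_of_deriv_le (μ := hm) (𝕜 := ℝ) (F := G) (F' := G')
      (x₀ := t0) (s := ball t0 1) (bound := K.indicator fun z => C * normSq (jac f z))
      (ball_mem_nhds t0 one_pos)
      (by
        filter_upwards [ball_mem_nhds t0 one_pos] with t ht
        exact (hGc t (hI t ht)).aestronglyMeasurable)
      (hGc t0 ht03) hin.1.aestronglyMeasurable
      (Eventually.of_forall fun z t ht => by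
        by_cases hz : z ∈ D0
        · simp only [G', indicator_of_mem hz, hψd]
          by_cases hzK : z ∈ K
          · rw [indicator_of_mem hzK, norm_mul]
            refine mul_le_mul (hC _) ?_ (norm_nonneg _) ((norm_nonneg _).trans (hC 0))
            rw [Real.norm_eq_abs, abs_of_nonneg (normSq_nonneg _)]
          · rw [indicator_of_notMem hzK]
            have h1 : f z ∉ closedBall w0 (4 * ρ) := fun h => hzK ⟨hz, h⟩
            have h2 : fderiv ℝ (ψ t) (f z) (-v) = 0 := by
              have h3 : ψ t =ᶠ[nhds (f z)] fun _ => 0 := by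
                filter_upwards [isClosed_closedBall.isOpen_compl.mem_nhds h1] with w hw
                exact hψK t (hI t ht) w hw
              rw [h3.fderiv_eq]; simp
            rw [hψd] at h2
            rw [h2]; simp
        · have hzK : z ∉ K := fun h => hz h.1
          simp only [G', indicator_of_notMem hz, indicator_of_notMem hzK, norm_zero, le_refl])
      hbound
      (Eventually.of_forall fun z t ht => by
        by_cases hz : z ∈ D0
        · simp only [G, G', indicator_of_mem hz, hψd]
          refine HasDerivAt.mul_const ?_ _
          have h1 : HasDerivAt (fun t : ℝ => f z - w0 - t • v) (-v) t := by
            simpa using ((hasDerivAt_id t).smul_const v).const_sub (f z - w0)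
          exact (hφ.differentiable one_ne_zero _).hasFDerivAt.comp_hasDerivAt t h1
        · simp only [G, G', indicator_of_notMem hz]
          exact hasDerivAt_const _ _)
    have h2 := this.2
    rwa [show (∫ z, G' t0 z ∂hm) = 0 from hin.2] at h2
  exact constant_of_has_deriv_right_zero (f := fun t => ∫ z, G t z ∂hm) (a := 0) (b := 1)
    (fun t ht => (hder t ht).continuousAt.continuousWithinAt)
    (fun t ht => (hder t ⟨ht.1, ht.2.le⟩).hasDerivWithinAt) 1 (by simp)

theorem proper_surj {D0 C' : Set C2} {f : C2 → C2} (hD0 : IsOpen D0) (hne : D0.Nonempty)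
    (hC' : IsOpen C') (hC'c : IsPreconnected C') (hf : DifferentiableOn ℂ f D0) (hfm : MapsTo f D0 C')
    (hfp : ∀ K : Set C2, K ⊆ C' → IsCompact K → IsCompact (D0 ∩ f ⁻¹' K))
    (hJ : ∀ U : Set C2, IsOpen U → U ⊆ D0 → U.Nonempty → ∃ z ∈ U, jac f z ≠ 0) :
    ∀ w ∈ C', ∃ z ∈ D0, f z = w := by
  have hcl : ∀ w ∈ C', w ∈ closure (f '' D0) → w ∈ f '' D0 := by
    intro w hw hwc
    obtain ⟨ε, hε, hb⟩ := Metric.nhds_basis_closedBall.mem_iff.1 (hC'.mem_nhds hw)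
    have hK := hfp _ hb (isCompact_closedBall _ _)
    have him := (hK.image_of_continuousOn (hf.continuousOn.mono inter_subset_left)).isClosed
    have : w ∈ closure (f '' (D0 ∩ f ⁻¹' closedBall w ε)) := by
      rw [mem_closure_iff_nhds] at hwc ⊢
      intro t ht
      obtain ⟨y, ⟨hy1, hy2⟩, z, hz, rfl⟩ := hwc _ (inter_mem ht (closedBall_mem_nhds w hε))
      exact ⟨f z, hy1, z, ⟨hz, hy2⟩, rfl⟩
    rw [him.closure_eq] at this
    obtain ⟨z, hz, rfl⟩ := this
    exact ⟨z, hz.1, rfl⟩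
  have hop : ∀ w0 ∈ f '' D0, f '' D0 ∈ nhds w0 := by
    rintro w0 ⟨z0, hz0, rfl⟩
    by_contra hnot
    set w0 := f z0 with hw0
    obtain ⟨η, hη, hb⟩ := Metric.nhds_basis_closedBall.mem_iff.1 (hC'.mem_nhds (hfm hz0))
    set ρ := η / 4 with hρ
    have hρ0 : 0 < ρ := by positivity
    obtain ⟨w1, hw1, hw1R⟩ : ∃ w1 ∈ ball w0 ρ, w1 ∉ f '' D0 := by
      by_contra hc
      push Not at hc
      exact hnot (mem_of_superset (ball_mem_nhds w0 hρ0) hc)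
    have hw1C : w1 ∈ C' := hb (by
      have : dist w1 w0 < ρ := hw1
      rw [mem_closedBall]; linarith)
    have hw1n : (closure (f '' D0))ᶜ ∈ nhds w1 :=
      isClosed_closure.isOpen_compl.mem_nhds fun h => hw1R (hcl w1 hw1C h)
    obtain ⟨ε1, hε1, hb1⟩ := Metric.mem_nhds_iff.1 hw1n
    set ε := min ε1 ρ with hε
    have hε0 : 0 < ε := lt_min hε1 hρ0
    let φ : ContDiffBump (0 : C2) := ⟨ε / 2, ε, by positivity, by linarith⟩
    have hφ : ContDiff ℝ 1 φ := φ.contDiff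
    have hφ0 : ∀ w, ε ≤ ‖w‖ → φ w = 0 := fun w hw => φ.zero_of_le_dist (by simpa using hw)
    have hK : IsCompact (D0 ∩ f ⁻¹' (closedBall w0 (4 * ρ))) := by
      have : 4 * ρ = η := by rw [hρ]; ring
      rw [this]; exact hfp _ hb (isCompact_closedBall _ _)
    have hm1 := mass_const hD0 hf hφ (ρ := ρ) (fun w hw => hφ0 w ((min_le_right _ _).trans hw))
      (w0 := w0) (v := w1 - w0) (by
        have : dist w1 w0 < ρ := hw1
        rw [← dist_eq_norm]; exact this.le) hK
    have hz1 : ∀ z, D0.indicator (fun z => φ (f z - w0 - (1 : ℝ) • (w1 - w0)) * normSq (jac f z)) z = 0 := by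
      intro z
      by_cases hz : z ∈ D0
      · rw [indicator_of_mem hz]
        have h1 : f z - w0 - (1 : ℝ) • (w1 - w0) = f z - w1 := by rw [one_smul]; abel
        rw [h1, hφ0, zero_mul]
        by_contra hc
        have h2 : f z ∈ ball w1 ε1 := by
          rw [mem_ball, dist_eq_norm]
          exact (not_le.1 hc).trans_le (min_le_left _ _)
        exact hb1 h2 (subset_closure ⟨z, hz, rfl⟩)
      · rw [indicator_of_notMem hz]
    rw [MeasureTheory.integral_congr_ae (Eventually.of_forall hz1)] at hm1
    simp only [MeasureTheory.integral_zero, zero_smul, sub_zero] at hm1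
    -- but the mass at `0` is positive
    let ψ : C2 → ℝ := fun w => φ (w - w0)
    have hψ : ContDiff ℝ 1 ψ := hφ.comp (by fun_prop)
    have hψK : ∀ w, w ∉ closedBall w0 (4 * ρ) → ψ w = 0 := by
      intro w hw
      apply hφ0
      rw [mem_closedBall, dist_eq_norm, not_le] at hw
      have := min_le_right ε1 ρ
      linarith
    have hJh := jac_hol hD0 hf
    have hs := EE_smooth hD0 hf hψ hψK hK hJh hJh
    have hG : (fun z => (EE D0 f ψ (jac f) (jac f) z).re) =
        D0.indicator (fun z => φ (f z - w0) * normSq (jac f z)) := by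
      funext z
      by_cases hz : z ∈ D0
      · simp only [ψ, EE, indicator_of_mem hz]
        rw [mul_assoc, ← normSq_eq_conj_mul_self, ← ofReal_mul, ofReal_re]
      · simp only [EE, indicator_of_notMem hz, zero_re]
    have hfc := hf.continuousOn
    obtain ⟨z2, ⟨hz2D, hz2b⟩, hz2J⟩ := hJ (D0 ∩ f ⁻¹' ball w0 ε) (hfc.isOpen_inter_preimage hD0 isOpen_ball)
      inter_subset_left ⟨z0, hz0, mem_ball_self hε0⟩
    have hpos := Continuous.integral_pos_of_hasCompactSupport_nonneg_nonzero (μ := hm) (x := z2)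
      (Complex.continuous_re.comp hs.1.continuous) (hs.2.comp_left (g := Complex.re) rfl)
      (by
        intro z
        change 0 ≤ (fun z => (EE D0 f ψ (jac f) (jac f) z).re) z
        rw [hG]
        exact indicator_nonneg (fun z _ => mul_nonneg φ.nonneg (normSq_nonneg _)) z)
      (by
        change (fun z => (EE D0 f ψ (jac f) (jac f) z).re) z2 ≠ 0
        rw [hG, indicator_of_mem hz2D]
        refine mul_ne_zero (φ.pos_of_mem_ball ?_).ne' (by simpa using hz2J)
        rw [mem_ball_zero_iff, ← dist_eq_norm]; exact hz2b)
    have hpos' : 0 < ∫ z, (fun z => (EE D0 f ψ (jac f) (jac f) z).re) z ∂hm := hpos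
    rw [hG] at hpos'
    linarith
  have hopen : IsOpen (f '' D0) := isOpen_iff_mem_nhds.2 hop
  have hsub : C' ⊆ f '' D0 := by
    refine hC'c.subset_of_closure_inter_subset hopen ?_ ?_
    · obtain ⟨z, hz⟩ := hne
      exact ⟨f z, hfm hz, z, hz, rfl⟩
    · rintro w ⟨h1, h2⟩
      exact hcl w h2 h1
  intro w hw
  obtain ⟨z, hz, h⟩ := hsub hw
  exact ⟨z, hz, h⟩

/-- Real Hessian. -/
def hess (ρ : C2 → ℝ) (q : C2) : C2 →L[ℝ] C2 →L[ℝ] ℝ := fderiv ℝ (fderiv ℝ ρ) q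

theorem c2_diff {E G : Type*} [NormedAddCommGroup E] [NormedSpace ℝ E] [NormedAddCommGroup G]
    [NormedSpace ℝ G] {ρ : E → G} {q : E} (h : ContDiffAt ℝ 2 ρ q) :
    (∀ᶠ y in nhds q, ContDiffAt ℝ 2 ρ y) ∧ (∀ᶠ y in nhds q, DifferentiableAt ℝ ρ y) ∧
      DifferentiableAt ℝ (fderiv ℝ ρ) q ∧ ContinuousAt (fderiv ℝ (fderiv ℝ ρ)) q := by
  have h1 : ContDiffAt ℝ 1 (fderiv ℝ ρ) q := h.fderiv_right (by norm_num)
  have h0 := h.eventually (by simp)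
  refine ⟨h0, h0.mono fun y hy => hy.differentiableAt (by norm_num),
    h1.differentiableAt one_ne_zero, ?_⟩
  exact (h1.fderiv_right (m := 0) (by norm_num)).continuousAt

theorem hess_symm {ρ : C2 → ℝ} {q : C2} (h : ContDiffAt ℝ 2 ρ q) (u v : C2) :
    hess ρ q u v = hess ρ q v u := h.isSymmSndFDerivAt (by simp) u v

theorem fderiv_dir {ρ : C2 → ℝ} {q : C2} (h : ContDiffAt ℝ 2 ρ q) (v : C2) :
    HasFDerivAt (fun y => fderiv ℝ ρ y v) ((hess ρ q).flip v) q := by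
  have := (c2_diff h).2.2.1.hasFDerivAt.clm_apply (hasFDerivAt_const v q)
  refine this.congr_fderiv ?_
  ext <;> simp [hess]

theorem fderiv_wdb {ρ : C2 → ℝ} {q : C2} (h : ContDiffAt ℝ 2 ρ q) (v w u : C2) :
    fderiv ℝ (fun y => (1 / 2 : ℂ) * (fderiv ℝ (oc ρ) y v + Complex.I * fderiv ℝ (oc ρ) y w)) q u =
      (1 / 2 : ℂ) * ((hess ρ q u v : ℝ) + Complex.I * (hess ρ q u w : ℝ)) := by
  have e : (fun y => (1 / 2 : ℂ) * (fderiv ℝ (oc ρ) y v + Complex.I * fderiv ℝ (oc ρ) y w)) =ᶠ[nhds q]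
      fun y => (1 / 2 : ℂ) * (Complex.ofRealCLM (fderiv ℝ ρ y v) + Complex.I * Complex.ofRealCLM (fderiv ℝ ρ y w)) := by
    filter_upwards [(c2_diff h).2.1] with y hy
    rw [fderiv_oc hy, fderiv_oc hy]; rfl
  rw [e.fderiv_eq]
  have h1 := Complex.ofRealCLM.hasFDerivAt.comp q (fderiv_dir h v)
  have h2 := Complex.ofRealCLM.hasFDerivAt.comp q (fderiv_dir h w)
  have h3 := (h1.add (h2.const_mul Complex.I)).const_mul (1 / 2 : ℂ)
  have h4 : fderiv ℝ (fun y => (1 / 2 : ℂ) * (Complex.ofRealCLM (fderiv ℝ ρ y v)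
    + Complex.I * Complex.ofRealCLM (fderiv ℝ ρ y w))) q = _ := h3.fderiv
  rw [h4]
  simp
  ring

theorem levi_re {ρ : C2 → ℝ} {q : C2} (h : ContDiffAt ℝ 2 ρ q) (t : C2) :
    (levi ρ q t).re = (1 / 4) * (hess ρ q t t + hess ρ q (I • t) (I • t)) := by
  have e1 : t = t.1.re • ((1, 0) : C2) + t.1.im • ((I, 0) : C2) + t.2.re • ((0, 1) : C2)
      + t.2.im • ((0, I) : C2) := by
    ext <;> simp
  have e2 : I • t = (-t.1.im) • ((1, 0) : C2) + t.1.re • ((I, 0) : C2) + (-t.2.im) • ((0, 1) : C2)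
      + t.2.re • ((0, I) : C2) := by
    ext1 <;> apply Complex.ext <;> simp
  have k1 : hess ρ q t t = hess ρ q (t.1.re • ((1, 0) : C2) + t.1.im • ((I, 0) : C2)
      + t.2.re • ((0, 1) : C2) + t.2.im • ((0, I) : C2)) (t.1.re • ((1, 0) : C2)
      + t.1.im • ((I, 0) : C2) + t.2.re • ((0, 1) : C2) + t.2.im • ((0, I) : C2)) := by
    rw [← e1]
  rw [k1, e2]
  simp only [map_add, map_smul, smul_eq_mul, ContinuousLinearMap.add_apply, ContinuousLinearMap.smul_apply]
  have w1 := fun v w u => fderiv_wdb h v w u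
  unfold levi
  have a1 : wdbar1 (oc ρ) = fun y => (1 / 2 : ℂ) * (fderiv ℝ (oc ρ) y (1, 0) + Complex.I * fderiv ℝ (oc ρ) y (I, 0)) := rfl
  have a2 : wdbar2 (oc ρ) = fun y => (1 / 2 : ℂ) * (fderiv ℝ (oc ρ) y (0, 1) + Complex.I * fderiv ℝ (oc ρ) y (0, I)) := rfl
  rw [a1, a2]
  unfold wd1 wd2
  simp only [fderiv_wdb h]
  rw [hess_symm h (I, 0) (1, 0), hess_symm h (0, 1) (1, 0), hess_symm h (0, I) (1, 0),
    hess_symm h (0, 1) (I, 0), hess_symm h (0, I) (I, 0), hess_symm h (0, I) (0, 1)]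
  simp
  ring

theorem tangent_iff {ρ : C2 → ℝ} {q : C2} (h : DifferentiableAt ℝ ρ q) (t : C2) :
    tangentVec ρ q t ↔ fderiv ℝ ρ q t = 0 ∧ fderiv ℝ ρ q (I • t) = 0 := by
  have e : wd1 (oc ρ) q * t.1 + wd2 (oc ρ) q * t.2 =
      (1 / 2 : ℂ) * ((fderiv ℝ ρ q t : ℝ) - I * (fderiv ℝ ρ q (I • t) : ℝ)) := by
    rw [fd_decomp _ t, fd_decomp _ (I • t)]
    unfold wd1 wd2
    simp only [fderiv_oc h]
    apply Complex.ext <;> simp <;> ring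
  unfold tangentVec
  rw [e, Complex.ext_iff]
  simp

theorem levi_closed {ρ : C2 → ℝ} {q : C2} (h : ContDiffAt ℝ 2 ρ q) (hd : fderiv ℝ ρ q ≠ 0)
    (hf : ∃ᶠ y in nhds q, PseudoconvexAt ρ y) : PseudoconvexAt ρ q := by
  intro t ht
  set τ : C2 → C2 := fun y => (- wd2 (oc ρ) y, wd1 (oc ρ) y) with hτ
  have hc1 : ContinuousAt (fun y => fderiv ℝ ρ y) q := (c2_diff h).2.2.1.continuousAt
  have hwd : ∀ v w : C2, ContinuousAt (fun y => (1 / 2 : ℂ) * (fderiv ℝ (oc ρ) y v - I * fderiv ℝ (oc ρ) y w)) q := by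
    intro v w
    have e : (fun y => (1 / 2 : ℂ) * (((fderiv ℝ ρ y v : ℝ) : ℂ) - I * ((fderiv ℝ ρ y w : ℝ) : ℂ))) =ᶠ[nhds q]
       (fun y => (1 / 2 : ℂ) * (fderiv ℝ (oc ρ) y v - I * fderiv ℝ (oc ρ) y w)) := by
      filter_upwards [(c2_diff h).2.1] with y hy
      rw [fderiv_oc hy, fderiv_oc hy]
    refine ContinuousAt.congr ?_ e
    have c1 : ContinuousAt (fun y => ((fderiv ℝ ρ y v : ℝ) : ℂ)) q :=
      Complex.continuous_ofReal.continuousAt.comp (hc1.clm_apply continuousAt_const)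
    have c2 : ContinuousAt (fun y => ((fderiv ℝ ρ y w : ℝ) : ℂ)) q :=
      Complex.continuous_ofReal.continuousAt.comp (hc1.clm_apply continuousAt_const)
    exact continuousAt_const.mul (c1.sub (continuousAt_const.mul c2))
  have hτc : ContinuousAt τ q := ContinuousAt.prodMk (hwd _ _).neg (hwd _ _)
  have hnz : wd1 (oc ρ) q ≠ 0 ∨ wd2 (oc ρ) q ≠ 0 := by
    by_contra hc
    push Not at hc
    apply hd
    ext v
    · exact ((tangent_iff (h.differentiableAt (by norm_num)) _).1 (show tangentVec ρ q (v, 0) by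
        unfold tangentVec; simp [hc.1])).1
    · exact ((tangent_iff (h.differentiableAt (by norm_num)) _).1 (show tangentVec ρ q (0, v) by
        unfold tangentVec; simp [hc.2])).1
  obtain ⟨l, hl⟩ : ∃ l : ℂ, t = l • τ q := by
    unfold tangentVec at ht
    rcases hnz with h0 | h0
    · refine ⟨t.2 / wd1 (oc ρ) q, ?_⟩
      ext
      · simp [hτ]; field_simp; linear_combination ht
      · simp [hτ]; field_simp
    · refine ⟨- t.1 / wd2 (oc ρ) q, ?_⟩
      ext
      · simp [hτ]; field_simp
      · simp [hτ]; field_simp; linear_combination ht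
  set Φ : C2 → ℝ := fun y => (1 / 4) * (hess ρ y (l • τ y) (l • τ y) + hess ρ y (I • l • τ y) (I • l • τ y)) with hΦ
  have hΦc : ContinuousAt Φ q := by
    have c1 : ContinuousAt (fun y => hess ρ y) q := (c2_diff h).2.2.2
    have c2 : ContinuousAt (fun y => l • τ y) q := hτc.const_smul l
    have c3 : ContinuousAt (fun y => I • l • τ y) q := c2.const_smul I
    exact continuousAt_const.mul (((c1.clm_apply c2).clm_apply c2).add ((c1.clm_apply c3).clm_apply c3))
  rw [levi_re h, hl]
  by_contra hc
  have hneg : ∀ᶠ y in nhds q, Φ y < 0 := hΦc.eventually_lt continuousAt_const (not_le.1 hc)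
  obtain ⟨y, hy1, hy2, hy3⟩ := (hf.and_eventually (hneg.and (c2_diff h).1)).exists
  have := hy1 (l • τ y) (by unfold tangentVec; simp [hτ]; ring)
  rw [levi_re hy3] at this
  exact absurd hy2 (not_lt.2 this)

theorem jac_surj {F : C2 → C2} {z : C2} (hJ : jac F z ≠ 0) (t' : C2) : ∃ t, fderiv ℂ F z t = t' := by
  set a := fderiv ℂ F z (1, 0) with ha
  set b := fderiv ℂ F z (0, 1) with hb
  have hJ' : a.1 * b.2 - b.1 * a.2 ≠ 0 := hJ
  refine ⟨((t'.1 * b.2 - b.1 * t'.2) / (a.1 * b.2 - b.1 * a.2),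
    (a.1 * t'.2 - t'.1 * a.2) / (a.1 * b.2 - b.1 * a.2)), ?_⟩
  have hd : ∀ x y : ℂ, fderiv ℂ F z (x, y) = x • a + y • b := by
    intro x y
    rw [ha, hb, ← map_smul, ← map_smul, ← map_add]
    simp
  rw [hd]
  ext
  · simp only [Prod.fst_add, Prod.smul_fst, smul_eq_mul]
    rw [div_mul_eq_mul_div, div_mul_eq_mul_div, ← add_div, div_eq_iff hJ']; ring
  · simp only [Prod.snd_add, Prod.smul_snd, smul_eq_mul]
    rw [div_mul_eq_mul_div, div_mul_eq_mul_div, ← add_div, div_eq_iff hJ']; ring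

theorem chain1 {r' : C2 → ℝ} {F : C2 → C2} {x : C2} (hr' : DifferentiableAt ℝ r' (F x))
    (hF : DifferentiableAt ℂ F x) (v : C2) :
    fderiv ℝ (fun y => r' (F y)) x v = fderiv ℝ r' (F x) (fderiv ℂ F x v) := by
  have := (hr'.hasFDerivAt.comp x (hF.hasFDerivAt.restrictScalars ℝ)).fderiv
  change fderiv ℝ (r' ∘ F) x v = _
  rw [this]; rfl

theorem chain2 {r' : C2 → ℝ} {F : C2 → C2} {z : C2} {U : Set C2} (hU : IsOpen U) (hz : z ∈ U)
    (hr' : ContDiffAt ℝ 2 r' (F z)) (hF : DifferentiableOn ℂ F U) (u v : C2) :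
    hess (fun y => r' (F y)) z u v = hess r' (F z) (fderiv ℂ F z u) (fderiv ℂ F z v)
      + fderiv ℝ r' (F z) (fderiv ℂ (fun x => fderiv ℂ F x v) z u) := by
  have hFd := hF.differentiableAt (hU.mem_nhds hz)
  have hFR : ContDiffAt ℝ 2 F z :=
    ((hol_contDiffOn hU 2 hF).contDiffAt (hU.mem_nhds hz)).restrict_scalars ℝ
  have hRc : ContDiffAt ℝ 2 (fun y => r' (F y)) z := hr'.comp z hFR
  have h1 := (fderiv_dir hRc v).fderiv
  have e : (fun y => fderiv ℝ (fun y => r' (F y)) y v) =ᶠ[nhds z]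
      fun y => fderiv ℝ r' (F y) (fderiv ℂ F y v) := by
    filter_upwards [hU.mem_nhds hz, hFd.continuousAt.eventually (c2_diff hr').2.1] with y hy hy'
    exact chain1 hy' (hF.differentiableAt (hU.mem_nhds hy)) v
  rw [e.fderiv_eq] at h1
  have d1 : HasFDerivAt (fun y => fderiv ℝ r' (F y)) _ z :=
    (c2_diff hr').2.2.1.hasFDerivAt.comp z (hFd.hasFDerivAt.restrictScalars ℝ)
  have d2 := ((fderiv_dir_hol hU hF v).differentiableAt (hU.mem_nhds hz)).hasFDerivAt.restrictScalars ℝ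
  have d3 := (d1.clm_apply d2).fderiv
  rw [d3] at h1
  have h2 := congrArg (fun L => L u) h1
  simp only [ContinuousLinearMap.flip_apply] at h2
  rw [← h2]
  simp [hess, add_comm]

theorem chain_levi {r' : C2 → ℝ} {F : C2 → C2} {z : C2} {U : Set C2} (hU : IsOpen U) (hz : z ∈ U)
    (hr' : ContDiffAt ℝ 2 r' (F z)) (hF : DifferentiableOn ℂ F U) (t : C2) :
    hess (fun y => r' (F y)) z t t + hess (fun y => r' (F y)) z (I • t) (I • t) =
    hess r' (F z) (fderiv ℂ F z t) (fderiv ℂ F z t)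
      + hess r' (F z) (I • fderiv ℂ F z t) (I • fderiv ℂ F z t) := by
  rw [chain2 hU hz hr' hF, chain2 hU hz hr' hF]
  have e : fderiv ℂ (fun x => fderiv ℂ F x (I • t)) z (I • t) = - fderiv ℂ (fun x => fderiv ℂ F x t) z t := by
    have h1 : (fun x => fderiv ℂ F x (I • t)) = fun x => I • fderiv ℂ F x t := by
      funext x; rw [map_smul]
    have h2 := (((fderiv_dir_hol hU hF t).differentiableAt (hU.mem_nhds hz)).hasFDerivAt.const_smul I).fderiv
    have h3 : fderiv ℂ (fun x => I • fderiv ℂ F x t) z = _ := h2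
    rw [h1, h3]
    rw [ContinuousLinearMap.smul_apply, map_smul, smul_smul, I_mul_I, neg_one_smul]
  rw [e, map_neg, map_smul]
  ring

/-- Second-order contact along a hypersurface. -/
theorem hess_curve {r S : C2 → ℝ} {z v e : C2} (hr : ContDiffAt ℝ 2 r z) (hr0 : r z = 0)
    (he : fderiv ℝ r z e ≠ 0) (hv : fderiv ℝ r z v = 0) (hS : ContDiffAt ℝ 2 S z)
    (hSr : ∀ᶠ y in nhds z, r y = 0 → S y = 0) :
    fderiv ℝ S z v = 0 ∧ (fderiv ℝ S z = 0 → hess S z v v = 0) := by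
  obtain ⟨T, hTc, hT0, hT1, -⟩ := impl_dir (n := 2) (by norm_num) hr hr0 he
  set γ : ℝ → C2 := fun s => z + s • v + T (z + s • v) • e with hγ
  have hγ0 : γ 0 = z := by simp [hγ, hT0]
  have hlin : ContDiff ℝ 2 (fun s : ℝ => z + s • v) := by fun_prop
  have hl0 : z + (0 : ℝ) • v = z := by simp
  have hTl : ContDiffAt ℝ 2 (fun s : ℝ => T (z + s • v)) 0 := by
    refine ContDiffAt.comp (f := fun s : ℝ => z + s • v) 0 ?_ hlin.contDiffAt
    rw [hl0]; exact hTc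
  have hγc : ContDiffAt ℝ 2 γ 0 := hlin.contDiffAt.add (hTl.smul contDiffAt_const)
  have hγt : Tendsto γ (nhds 0) (nhds z) := ca_tendsto hγc.continuousAt hγ0
  have hγr : ∀ᶠ s in nhds (0 : ℝ), r (γ s) = 0 :=
    (ca_tendsto hlin.continuous.continuousAt hl0).eventually hT1
  have hγS : ∀ᶠ s in nhds (0 : ℝ), S (γ s) = 0 := by
    filter_upwards [hγr, hγt.eventually hSr] with s h1 h2
    exact h2 h1
  have hγd : ∀ᶠ s in nhds (0 : ℝ), DifferentiableAt ℝ γ s := (c2_diff hγc).2.1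
  have key : ∀ Q : C2 → ℝ, ContDiffAt ℝ 2 Q z → (∀ᶠ s in nhds (0 : ℝ), Q (γ s) = 0) →
      ∀ᶠ s in nhds (0 : ℝ), fderiv ℝ Q (γ s) (deriv γ s) = 0 := by
    intro Q hQ hQ0
    filter_upwards [hQ0.eventually_nhds, hγd, hγt.eventually (c2_diff hQ).2.1] with s h1 h2 h3
    have h4 := (h3.hasFDerivAt.comp_hasDerivAt s h2.hasDerivAt).deriv
    have h5 : (Q ∘ γ) =ᶠ[nhds s] fun _ => 0 := h1
    rw [← h4, h5.deriv_eq]; simp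
  have hd0 : deriv γ 0 = v + deriv (fun s : ℝ => T (z + s • v)) 0 • e := by
    have h1 : HasDerivAt (fun s : ℝ => z + s • v) v 0 := by
      simpa using ((hasDerivAt_id (0 : ℝ)).smul_const v).const_add z
    have h2 := (hTl.differentiableAt (by norm_num)).hasDerivAt.smul_const e
    exact (h1.add h2).deriv
  have hdv : deriv γ 0 = v := by
    have h1 := (key r hr hγr).self_of_nhds
    rw [hγ0, hd0, map_add, map_smul, hv, zero_add, smul_eq_mul] at h1
    rw [hd0, (mul_eq_zero.1 h1).resolve_right he]; simp
  have hk := key S hS hγS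
  constructor
  · have := hk.self_of_nhds
    rwa [hγ0, hdv] at this
  · intro hz
    have hγ' : HasDerivAt γ v 0 := by
      have := (hγc.differentiableAt (by norm_num)).hasDerivAt
      rwa [hdv] at this
    have c1 : HasDerivAt (fun s => fderiv ℝ S (γ s)) (hess S z v) 0 := by
      refine HasFDerivAt.comp_hasDerivAt (f := γ) (l := fderiv ℝ S) (l' := hess S z) 0 ?_ hγ'
      rw [hγ0]; exact (c2_diff hS).2.2.1.hasFDerivAt
    have c2 : DifferentiableAt ℝ (deriv γ) 0 := by
      have : DifferentiableAt ℝ (fun s => fderiv ℝ γ s 1) 0 :=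
        (c2_diff hγc).2.2.1.clm_apply (differentiableAt_const _)
      simpa using this
    have c3 := (c1.clm_apply c2.hasDerivAt).deriv
    have c4 : (fun s => fderiv ℝ S (γ s) (deriv γ s)) =ᶠ[nhds 0] fun _ => 0 := hk
    rw [c4.deriv_eq, hγ0, hz, hdv] at c3
    simpa using c3.symm

theorem levi_transfer {r r' : C2 → ℝ} {F : C2 → C2} {z : C2} {U : Set C2} (hU : IsOpen U) (hz : z ∈ U)
    (hr : ContDiffAt ℝ 2 r z) (hr0 : r z = 0) (hdr : fderiv ℝ r z ≠ 0)
    (hr' : ContDiffAt ℝ 2 r' (F z)) (hdr' : fderiv ℝ r' (F z) ≠ 0)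
    (hF : DifferentiableOn ℂ F U) (hJ : jac F z ≠ 0)
    (h0 : ∀ᶠ y in nhds z, r y = 0 → r' (F y) = 0)
    (hneg : ∀ᶠ y in nhds z, r y < 0 → r' (F y) < 0)
    (hps : PseudoconvexAt r z) : PseudoconvexAt r' (F z) := by
  intro t' ht'
  have hFd := hF.differentiableAt (hU.mem_nhds hz)
  have hFR : ContDiffAt ℝ 2 F z :=
    ((hol_contDiffOn hU 2 hF).contDiffAt (hU.mem_nhds hz)).restrict_scalars ℝ
  set R : C2 → ℝ := fun y => r' (F y) with hR
  have hRc : ContDiffAt ℝ 2 R z := hr'.comp z hFR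
  have hr'd : DifferentiableAt ℝ r' (F z) := hr'.differentiableAt (by norm_num)
  have hrd : DifferentiableAt ℝ r z := hr.differentiableAt (by norm_num)
  have hRd : DifferentiableAt ℝ R z := hRc.differentiableAt (by norm_num)
  have hdR : ∀ v, fderiv ℝ R z v = fderiv ℝ r' (F z) (fderiv ℂ F z v) := chain1 hr'd hFd
  have hRne : fderiv ℝ R z ≠ 0 := by
    intro h
    apply hdr'
    refine ContinuousLinearMap.ext fun w => ?_
    obtain ⟨t, rfl⟩ := jac_surj hJ w
    rw [← hdR, h]; rfl
  obtain ⟨e0, he0⟩ := exists_dir hdr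
  obtain ⟨e, he⟩ : ∃ e, 0 < fderiv ℝ r z e := by
    rcases lt_or_gt_of_ne he0 with h | h
    · exact ⟨-e0, by rw [map_neg]; linarith⟩
    · exact ⟨e0, h⟩
  set c := fderiv ℝ R z e / fderiv ℝ r z e with hc
  have hker : ∀ v, fderiv ℝ r z v = 0 → fderiv ℝ R z v = 0 := fun v hv =>
    (hess_curve hr hr0 he.ne' hv hRc h0).1
  have hprop : ∀ v, fderiv ℝ R z v = c * fderiv ℝ r z v := by
    intro v
    have := hker (v - (fderiv ℝ r z v / fderiv ℝ r z e) • e) (by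
      rw [map_sub, map_smul, smul_eq_mul, div_mul_cancel₀ _ he.ne', sub_self])
    rw [map_sub, map_smul, smul_eq_mul] at this
    rw [hc]
    field_simp
    field_simp at this
    linarith
  have hcne : c ≠ 0 := by
    intro h
    apply hRne
    refine ContinuousLinearMap.ext fun w => ?_
    rw [hprop, h]; simp
  have hR0 : R z = 0 := h0.self_of_nhds hr0
  have hcpos : 0 < c := by
    refine lt_of_le_of_ne ?_ hcne.symm
    by_contra hcn
    have hRe : fderiv ℝ R z e < 0 := by
      rw [hprop]; exact mul_neg_of_neg_of_pos (not_le.1 hcn) he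
    have hl : HasDerivAt (fun s : ℝ => z + s • (-e)) (-e) 0 := by
      simpa using ((hasDerivAt_id (0 : ℝ)).smul_const (-e)).const_add z
    have hl0 : z + (0 : ℝ) • (-e) = z := by simp
    have d1 : HasDerivAt (fun s : ℝ => r (z + s • (-e))) (fderiv ℝ r z (-e)) 0 := by
      have q : HasFDerivAt r (fderiv ℝ r z) (z + (0 : ℝ) • (-e)) := by
        rw [hl0]; exact hrd.hasFDerivAt
      exact HasFDerivAt.comp_hasDerivAt (f := fun s : ℝ => z + s • (-e)) 0 q hl
    have d2 : HasDerivAt (fun s : ℝ => R (z + s • (-e))) (fderiv ℝ R z (-e)) 0 := by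
      have q : HasFDerivAt R (fderiv ℝ R z) (z + (0 : ℝ) • (-e)) := by
        rw [hl0]; exact hRd.hasFDerivAt
      exact HasFDerivAt.comp_hasDerivAt (f := fun s : ℝ => z + s • (-e)) 0 q hl
    have pos_of : ∀ {g : ℝ → ℝ} {m : ℝ}, HasDerivAt g m 0 → g 0 = 0 → 0 < m →
        ∀ᶠ s in nhdsWithin (0 : ℝ) (Ioi 0), 0 < g s := by
      intro g m hg hg0 hm
      have h1 := (hasDerivAt_iff_tendsto_slope.1 hg).mono_left
        (nhdsWithin_mono 0 (fun s (hs : (0 : ℝ) < s) => hs.ne'))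
      filter_upwards [h1.eventually (lt_mem_nhds hm), self_mem_nhdsWithin] with s h2 h3
      rw [slope_def_field, hg0, sub_zero, sub_zero] at h2
      exact (div_pos_iff_of_pos_right h3).1 h2
    have p1 := pos_of (g := fun s : ℝ => - r (z + s • (-e))) (m := - fderiv ℝ r z (-e)) d1.neg
      (by simp [hr0]) (by rw [map_neg]; linarith)
    have p2 := pos_of (g := fun s : ℝ => R (z + s • (-e))) (m := fderiv ℝ R z (-e)) d2
      (by simp [hR0]) (by rw [map_neg]; linarith)
    have p3 : ∀ᶠ s in nhdsWithin (0 : ℝ) (Ioi 0), r (z + s • (-e)) < 0 → R (z + s • (-e)) < 0 :=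
      ((ca_tendsto hl.continuousAt hl0).mono_left nhdsWithin_le_nhds).eventually hneg
    obtain ⟨s, q1, q2, q3⟩ := (p1.and (p2.and p3)).exists
    have q1' : 0 < - r (z + s • (-e)) := q1
    linarith [q3 (by linarith)]
  obtain ⟨t, rfl⟩ := jac_surj hJ t'
  obtain ⟨ht1, ht2⟩ := (tangent_iff hr'd _).1 ht'
  rw [← map_smul, ← hdR, hprop] at ht2
  rw [← hdR, hprop] at ht1
  have k1 := (mul_eq_zero.1 ht1).resolve_left hcne
  have k2 := (mul_eq_zero.1 ht2).resolve_left hcne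
  have hpos := hps t ((tangent_iff hrd t).2 ⟨k1, k2⟩)
  rw [levi_re hr] at hpos
  rw [levi_re hr', ← chain_levi hU hz hr' hF]
  -- compare Hessians of `R` and `c r`
  set S : C2 → ℝ := fun y => R y - c * r y with hS
  have hSc : ContDiffAt ℝ 2 S z := hRc.sub (contDiffAt_const.mul hr)
  have hSr : ∀ᶠ y in nhds z, r y = 0 → S y = 0 := by
    filter_upwards [h0] with y hy h
    simp only [hS, h, mul_zero, sub_zero]
    exact hy h
  have hSd : ∀ᶠ y in nhds z, fderiv ℝ S y = fderiv ℝ R y - c • fderiv ℝ r y := by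
    filter_upwards [(c2_diff hr).2.1, (c2_diff hRc).2.1] with y h1 h2
    exact (h2.hasFDerivAt.sub (h1.hasFDerivAt.const_mul c)).fderiv
  have hSz : fderiv ℝ S z = 0 := by
    rw [hSd.self_of_nhds]
    refine ContinuousLinearMap.ext fun w => ?_
    simp [hprop]
  have hSH : hess S z = hess R z - c • hess r z := by
    unfold hess
    have : fderiv ℝ S =ᶠ[nhds z] fun y => fderiv ℝ R y - c • fderiv ℝ r y := hSd
    rw [this.fderiv_eq]
    exact ((c2_diff hRc).2.2.1.hasFDerivAt.sub ((c2_diff hr).2.2.1.hasFDerivAt.const_smul c)).fderiv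
  have m1 := (hess_curve hr hr0 he.ne' k1 hSc hSr).2 hSz
  have m2 := (hess_curve hr hr0 he.ne' k2 hSc hSr).2 hSz
  rw [hSH] at m1 m2
  simp only [ContinuousLinearMap.sub_apply, ContinuousLinearMap.smul_apply, smul_eq_mul] at m1 m2
  have m3 : hess R z t t + hess R z (I • t) (I • t) = c * (hess r z t t + hess r z (I • t) (I • t)) := by
    linarith
  rw [m3]
  have : 0 ≤ hess r z t t + hess r z (I • t) (I • t) := by linarith
  positivity

theorem seg_lemma {r : C2 → ℝ} {q : C2} {B : Set C2} (hr : ContDiffAt ℝ 1 r q) (hr0 : r q = 0)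
    (hdr : fderiv ℝ r q ≠ 0) (hB : B ∈ nhds q) :
    ∃ c ∈ B, r c < 0 ∧ ∃ δ > 0, ∀ x ∈ ball q δ, r x < 0 →
      ∃ S : Set C2, IsPreconnected S ∧ x ∈ S ∧ c ∈ S ∧ ∀ y ∈ S, y ∈ B ∧ r y < 0 := by
  obtain ⟨e, he⟩ : ∃ e, 0 < fderiv ℝ r q e := by
    obtain ⟨e0, he0⟩ := exists_dir hdr
    rcases lt_or_gt_of_ne he0 with h | h
    · exact ⟨-e0, by rw [map_neg]; linarith⟩
    · exact ⟨e0, h⟩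
  have hcont : ContinuousAt (fun y => fderiv ℝ r y e) q := by
    have h1 : ContinuousAt (fderiv ℝ r) q :=
      (hr.fderiv_right (m := 0) (by norm_num)).continuousAt
    exact h1.clm_apply continuousAt_const
  have hdiff : ∀ᶠ y in nhds q, DifferentiableAt ℝ r y := by
    filter_upwards [hr.eventually (by simp)] with y hy
    exact hy.differentiableAt (by norm_num)
  obtain ⟨η, hη, hball⟩ := Metric.eventually_nhds_iff_ball.1
    ((hcont.eventually (lt_mem_nhds he)).and (hdiff.and hB))
  obtain ⟨s, hs, hse⟩ : ∃ s : ℝ, 0 < s ∧ s * ‖e‖ < η / 2 := by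
    refine ⟨η / 2 / (‖e‖ + 1), by positivity, ?_⟩
    rw [div_mul_eq_mul_div, div_lt_iff₀ (by positivity)]
    nlinarith [norm_nonneg e]
  have hin : ∀ x ∈ ball q (η / 2), ∀ t ∈ Icc 0 s, x - t • e ∈ ball q η := by
    intro x hx t ht
    rw [mem_ball, dist_eq_norm] at hx ⊢
    have h1 : x - t • e - q = (x - q) - t • e := by abel
    rw [h1]
    have h2 := norm_sub_le (x - q) (t • e)
    rw [norm_smul, Real.norm_eq_abs, abs_of_nonneg ht.1] at h2
    have h3 : t * ‖e‖ ≤ s * ‖e‖ := mul_le_mul_of_nonneg_right ht.2 (norm_nonneg e)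
    linarith
  have hmono : ∀ x ∈ ball q (η / 2), StrictAntiOn (fun t : ℝ => r (x - t • e)) (Icc 0 s) := by
    intro x hx
    have hd : ∀ t ∈ Icc 0 s, HasDerivAt (fun t : ℝ => r (x - t • e))
        (fderiv ℝ r (x - t • e) (-e)) t := by
      intro t ht
      have hl : HasDerivAt (fun t : ℝ => x - t • e) (-e) t := by
        simpa using ((hasDerivAt_id t).smul_const e).const_sub x
      exact HasFDerivAt.comp_hasDerivAt (f := fun t : ℝ => x - t • e) t
        (hball _ (hin x hx t ht)).2.1.hasFDerivAt hl
    refine strictAntiOn_of_deriv_neg (convex_Icc 0 s)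
      (fun t ht => (hd t ht).continuousAt.continuousWithinAt) ?_
    intro t ht
    have ht' := interior_subset ht
    rw [(hd t ht').deriv, map_neg]
    linarith [(hball _ (hin x hx t ht')).1]
  have hq : q ∈ ball q (η / 2) := mem_ball_self (by positivity)
  have hcneg : r (q - s • e) < 0 := by
    have := hmono q hq (left_mem_Icc.2 hs.le) (right_mem_Icc.2 hs.le) hs
    simpa [hr0] using this
  have hcin := hin q hq s (right_mem_Icc.2 hs.le)
  have hcc : ∀ᶠ y in nhds (q - s • e), r y < 0 :=
    (hball _ hcin).2.1.continuousAt.eventually (gt_mem_nhds hcneg)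
  obtain ⟨δ, hδ, hcb⟩ := Metric.eventually_nhds_iff_ball.1 hcc
  refine ⟨q - s • e, (hball _ hcin).2.2, hcneg, min δ (η / 2), by positivity, ?_⟩
  intro x hx hxneg
  have hxη : x ∈ ball q (η / 2) := ball_subset_ball (min_le_right _ _) hx
  have himg : IsPreconnected ((fun t : ℝ => x - t • e) '' Icc 0 s) :=
    isPreconnected_Icc.image _ (by fun_prop)
  refine ⟨((fun t : ℝ => x - t • e) '' Icc 0 s) ∪ ball (q - s • e) (min δ (η / 2)), ?_, ?_, ?_, ?_⟩
  · refine IsPreconnected.union (x - s • e) ⟨s, right_mem_Icc.2 hs.le, rfl⟩ ?_ himg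
      (convex_ball _ _).isPreconnected
    rw [mem_ball, dist_sub_right]; exact hx
  · exact Or.inl ⟨0, left_mem_Icc.2 hs.le, by simp⟩
  · exact Or.inr (mem_ball_self (by positivity))
  · rintro y (⟨t, ht, rfl⟩ | hy)
    · refine ⟨(hball _ (hin x hxη t ht)).2.2, ?_⟩
      have := (hmono x hxη).antitoneOn (left_mem_Icc.2 hs.le) ht ht.1
      simp only [zero_smul, sub_zero] at this
      exact lt_of_le_of_lt this hxneg
    · have h1 : y ∈ ball q η := by
        have h2 : y + s • e ∈ ball q (η / 2) := by
          have h3 := ball_subset_ball (min_le_right _ _) hy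
          rw [mem_ball, dist_eq_norm] at h3 ⊢
          convert h3 using 2
          abel
        simpa using hin _ h2 s (right_mem_Icc.2 hs.le)
      exact ⟨(hball _ h1).2.2, hcb _ (ball_subset_ball (min_le_left _ _) hy)⟩

theorem local_surj {D D' Ω' : Set C2} {F : C2 → C2} {p : C2} {ε : ℝ} {r' : C2 → ℝ}
    (hD : IsOpen D) (hD' : IsOpen D') (hε : 0 < ε) (hp : p ∈ frontier D)
    (hF : ∀ z ∈ closedBall p ε, DifferentiableAt ℂ F z)
    (hFD : ∀ z ∈ closedBall p ε, z ∈ D → F z ∈ D')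
    (hFM : ∀ z ∈ closedBall p ε, z ∈ frontier D → F z ∈ frontier D')
    (hiso : ∀ z ∈ closedBall p ε, z ∈ frontier D → F z = F p → z = p)
    (hΩ' : IsOpen Ω') (hpΩ' : F p ∈ Ω')
    (hr' : ContDiffAt ℝ 1 r' (F p)) (hdr' : fderiv ℝ r' (F p) ≠ 0) (hr'0 : r' (F p) = 0)
    (hr'D : D' ∩ Ω' = {p : C2 | p ∈ Ω' ∧ r' p < 0})
    (hJ : ∀ U, IsOpen U → U ⊆ D → U ⊆ ball p ε → U.Nonempty → ∃ z ∈ U, jac F z ≠ 0) :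
    ∃ δ > 0, ∀ q ∈ frontier D', q ∈ ball (F p) δ →
      ∃ z ∈ ball p ε, z ∈ frontier D ∧ F z = q := by
  have hdisj : ∀ w ∈ frontier D', w ∉ D' := fun w hw h => by
    rw [hD'.frontier_eq] at hw; exact hw.2 h
  have hdisj0 : ∀ w ∈ frontier D, w ∉ D := fun w hw h => by
    rw [hD.frontier_eq] at hw; exact hw.2 h
  have hfr : ∀ z ∈ closure D, z ∉ D → z ∈ frontier D := fun z h1 h2 => by
    rw [hD.frontier_eq]; exact ⟨h1, h2⟩
  have hFc : ContinuousOn F (closedBall p ε) := fun z hz =>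
    (hF z hz).continuousAt.continuousWithinAt
  have hKc : IsCompact (closure D ∩ sphere p ε) :=
    (isCompact_sphere p ε).inter_left isClosed_closure
  have hTc : IsCompact (closure D ∩ closedBall p ε) :=
    (isCompact_closedBall p ε).inter_left isClosed_closure
  have hFK : IsClosed (F '' (closure D ∩ sphere p ε)) :=
    (hKc.image_of_continuousOn (hFc.mono (fun z hz => sphere_subset_closedBall hz.2))).isClosed
  have hFT : IsClosed (F '' (closure D ∩ closedBall p ε)) :=
    (hTc.image_of_continuousOn (hFc.mono (fun z hz => hz.2))).isClosed
  have hpF : F p ∈ frontier D' := hFM p (mem_closedBall_self hε.le) hp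
  have hpK : F p ∉ F '' (closure D ∩ sphere p ε) := by
    rintro ⟨z, ⟨hz1, hz2⟩, hz3⟩
    have hzb := sphere_subset_closedBall hz2
    by_cases hzD : z ∈ D
    · exact hdisj _ hpF (hz3 ▸ hFD z hzb hzD)
    · have := hiso z hzb (hfr z hz1 hzD) hz3
      rw [this, mem_sphere, dist_self] at hz2
      exact hε.ne hz2
  obtain ⟨η, hη, hηb⟩ := Metric.mem_nhds_iff.1
    (inter_mem (hΩ'.mem_nhds hpΩ') (hFK.isOpen_compl.mem_nhds hpK))
  obtain ⟨c, hcB, hcneg, δ, hδ, hseg⟩ := seg_lemma hr' hr'0 hdr' (ball_mem_nhds (F p) hη)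
  have hneg : ∀ y ∈ ball (F p) η, (r' y < 0 ↔ y ∈ D') := by
    intro y hy
    have hyΩ := (hηb hy).1
    constructor
    · intro h
      have : y ∈ D' ∩ Ω' := by rw [hr'D]; exact ⟨hyΩ, h⟩
      exact this.1
    · intro h
      have : y ∈ D' ∩ Ω' := ⟨h, hyΩ⟩
      rw [hr'D] at this
      exact this.2
  set C' := connectedComponentIn (D' ∩ ball (F p) η) c with hC'
  have hC'o : IsOpen C' := (hD'.inter isOpen_ball).connectedComponentIn
  have hC's : C' ⊆ D' ∩ ball (F p) η := connectedComponentIn_subset _ _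
  have hinC : ∀ x ∈ ball (F p) (min δ η), x ∈ D' → x ∈ C' := by
    intro x hx hxD
    have hxη := ball_subset_ball (min_le_right _ _) hx
    obtain ⟨S, hS, hxS, hcS, hSs⟩ := hseg x (ball_subset_ball (min_le_left _ _) hx)
      ((hneg x hxη).2 hxD)
    have hsub : S ⊆ D' ∩ ball (F p) η :=
      fun y hy => ⟨(hneg y (hSs y hy).1).1 (hSs y hy).2, (hSs y hy).1⟩
    exact hS.subset_connectedComponentIn hcS hsub hxS
  set D0 := (D ∩ ball p ε) ∩ F ⁻¹' C' with hD0
  have hD0o : IsOpen D0 :=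
    (hFc.mono (fun z hz => ball_subset_closedBall hz.2)).isOpen_inter_preimage
      (hD.inter isOpen_ball) hC'o
  have hD0ne : D0.Nonempty := by
    have hp' : p ∈ closure D := frontier_subset_closure hp
    have hn : ball p ε ∩ F ⁻¹' (ball (F p) (min δ η)) ∈ nhds p :=
      inter_mem (ball_mem_nhds _ hε) ((hF p (mem_closedBall_self hε.le)).continuousAt.preimage_mem_nhds
        (ball_mem_nhds _ (lt_min hδ hη)))
    obtain ⟨z, ⟨hz1, hz2⟩, hz3⟩ := mem_closure_iff_nhds.1 hp' _ hn
    exact ⟨z, ⟨hz3, hz1⟩, hinC _ hz2 (hFD z (ball_subset_closedBall hz1) hz3)⟩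
  have hsurj := proper_surj (f := F) hD0o hD0ne hC'o isPreconnected_connectedComponentIn
    (fun z hz => (hF z (ball_subset_closedBall hz.1.2)).differentiableWithinAt)
    (fun z hz => hz.2)
    (by
      intro K hK hKc'
      have heq : D0 ∩ F ⁻¹' K = (closure D ∩ closedBall p ε) ∩ F ⁻¹' K := by
        ext z
        constructor
        · rintro ⟨⟨⟨h1, h2⟩, h3⟩, h4⟩
          exact ⟨⟨subset_closure h1, ball_subset_closedBall h2⟩, h4⟩
        · rintro ⟨⟨h1, h2⟩, h4⟩
          have h5 := hC's (hK h4)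
          refine ⟨⟨⟨?_, ?_⟩, hK h4⟩, h4⟩
          · by_contra h
            exact hdisj _ (hFM z h2 (hfr z h1 h)) h5.1
          · by_contra h
            refine (hηb h5.2).2 ⟨z, ⟨h1, ?_⟩, rfl⟩
            exact le_antisymm h2 (not_lt.1 h)
      rw [heq]
      refine hTc.of_isClosed_subset ?_ inter_subset_left
      exact (hFc.mono (fun z hz => hz.2)).preimage_isClosed_of_isClosed hTc.isClosed hKc'.isClosed)
    (fun U hU hUs hUne => hJ U hU (fun z hz => (hUs hz).1.1) (fun z hz => (hUs hz).1.2) hUne)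
  refine ⟨min δ η, lt_min hδ hη, fun q hq hqb => ?_⟩
  have hqT : q ∈ F '' (closure D ∩ closedBall p ε) := by
    rw [← hFT.closure_eq]
    refine mem_closure_iff_nhds.2 fun N hN => ?_
    obtain ⟨w, ⟨hw1, hw2⟩, hw3⟩ := mem_closure_iff_nhds.1 (frontier_subset_closure hq) _
      (inter_mem hN (isOpen_ball.mem_nhds hqb))
    obtain ⟨z, hz, rfl⟩ := hsurj w (hinC w hw2 hw3)
    exact ⟨F z, hw1, z, ⟨subset_closure hz.1.1, ball_subset_closedBall hz.1.2⟩, rfl⟩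
  obtain ⟨z, ⟨hz1, hz2⟩, rfl⟩ := hqT
  refine ⟨z, ?_, hfr z hz1 (fun h => hdisj _ hq (hFD z hz2 h)), rfl⟩
  by_contra h
  refine (hηb (ball_subset_ball (min_le_right _ _) hqb)).2 ⟨z, ⟨hz1, ?_⟩, rfl⟩
  exact le_antisymm hz2 (not_lt.1 h)


/-- Part of Theorem 1.2: pseudoconvexity is preserved. -/
theorem stmt3
    (D D' M M' : Set C2) (f : C2 → C2)
    (Ω : Set C2) (r : C2 → ℝ) (Ω' : Set C2) (r' : C2 → ℝ)
    -- `D`, `D'` are bounded domains in `ℂ²`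
    (hD : IsOpen D) (hDconn : IsConnected D) (hDbd : Bornology.IsBounded D)
    (hD' : IsOpen D') (hD'conn : IsConnected D') (hD'bd : Bornology.IsBounded D')
    -- `f : D → D'` is proper holomorphic
    (hf : DifferentiableOn ℂ f D) (hfm : Set.MapsTo f D D')
    (hfp : ∀ K : Set C2, K ⊆ D' → IsCompact K → IsCompact (D ∩ f ⁻¹' K))
    -- `M` is a nonempty relatively open piece of `∂D`, `M'` a relatively open piece of `∂D'`
    (hMne : M.Nonempty) (hMsub : M ⊆ frontier D)
    (hMopen : ∃ O : Set C2, IsOpen O ∧ M = frontier D ∩ O)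
    (hM'sub : M' ⊆ frontier D')
    (hM'open : ∃ O : Set C2, IsOpen O ∧ M' = frontier D' ∩ O)
    -- hypothesis (i): `∂D` is smooth real-analytic of finite type near `closure M`
    (hΩ : IsOpen Ω) (hMΩ : closure M ⊆ Ω)
    (hr : AnalyticOnNhd ℝ r Ω) (hrgrad : ∀ p ∈ Ω, fderiv ℝ r p ≠ 0)
    (hrbd : frontier D ∩ Ω = {p : C2 | p ∈ Ω ∧ r p = 0})
    (hrD : D ∩ Ω = {p : C2 | p ∈ Ω ∧ r p < 0})
    (hft : ∀ φ : ℂ → C2, DifferentiableOn ℂ φ (Metric.ball (0 : ℂ) 1) →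
      (∀ ζ ∈ Metric.ball (0 : ℂ) 1, φ ζ ∈ frontier D ∩ Ω) →
      ∀ a ∈ Metric.ball (0 : ℂ) 1, ∀ b ∈ Metric.ball (0 : ℂ) 1, φ a = φ b)
    -- hypothesis (ii): `∂D'` is smooth real-analytic of finite type near `closure M'`
    (hΩ' : IsOpen Ω') (hM'Ω' : closure M' ⊆ Ω')
    (hr' : AnalyticOnNhd ℝ r' Ω') (hr'grad : ∀ p ∈ Ω', fderiv ℝ r' p ≠ 0)
    (hr'bd : frontier D' ∩ Ω' = {p : C2 | p ∈ Ω' ∧ r' p = 0})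
    (hr'D : D' ∩ Ω' = {p : C2 | p ∈ Ω' ∧ r' p < 0})
    (hft' : ∀ φ : ℂ → C2, DifferentiableOn ℂ φ (Metric.ball (0 : ℂ) 1) →
      (∀ ζ ∈ Metric.ball (0 : ℂ) 1, φ ζ ∈ frontier D' ∩ Ω') →
      ∀ a ∈ Metric.ball (0 : ℂ) 1, ∀ b ∈ Metric.ball (0 : ℂ) 1, φ a = φ b)
    -- hypothesis (iii): the cluster set of `M` under `f` is contained in `M'`
    (hcl : ∀ p ∈ M, ∀ z : ℕ → C2, (∀ j, z j ∈ D) → Filter.Tendsto z Filter.atTop (nhds p) →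
      ∀ w' : C2, Filter.Tendsto (fun j => f (z j)) Filter.atTop (nhds w') → w' ∈ M')
    (p : C2) (hpM : p ∈ M)
    (W : Set C2) (hW : IsOpen W) (hpW : p ∈ W)
    (F : C2 → C2) (hF : DifferentiableOn ℂ F W) (hFf : ∀ z ∈ W ∩ D, F z = f z)
    (hnbhd : ∃ O : Set C2, IsOpen O ∧ p ∈ O ∧ ∀ q ∈ M ∩ O, PseudoconvexAt r q) :
    F p ∈ M' ∧
      ∃ O' : Set C2, IsOpen O' ∧ F p ∈ O' ∧ ∀ q ∈ M' ∩ O', PseudoconvexAt r' q := by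
  obtain ⟨O, hO, hMO⟩ := hMopen
  obtain ⟨O1, hO1, hpO1, hps⟩ := hnbhd
  have hFd : ∀ z ∈ W, DifferentiableAt ℂ F z := fun z hz => hF.differentiableAt (hW.mem_nhds hz)
  have hMsubΩ : ∀ z ∈ M, z ∈ Ω := fun z hz => hMΩ (subset_closure hz)
  have hM'subΩ : ∀ z ∈ M', z ∈ Ω' := fun z hz => hM'Ω' (subset_closure hz)
  have hMr : ∀ z ∈ M, r z = 0 := fun z hz => by
    have : z ∈ frontier D ∩ Ω := ⟨hMsub hz, hMsubΩ z hz⟩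
    rw [hrbd] at this; exact this.2
  have hM'r : ∀ z ∈ M', r' z = 0 := fun z hz => by
    have : z ∈ frontier D' ∩ Ω' := ⟨hM'sub hz, hM'subΩ z hz⟩
    rw [hr'bd] at this; exact this.2
  have hFM : ∀ z ∈ M, z ∈ W → F z ∈ M' := by
    intro z hz hzW
    have hzc : z ∈ closure (W ∩ D) := by
      refine mem_closure_iff_nhds.2 fun N hN => ?_
      obtain ⟨y, ⟨h1, h2⟩, h3⟩ := mem_closure_iff_nhds.1 (frontier_subset_closure (hMsub hz)) _
        (inter_mem hN (hW.mem_nhds hzW))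
      exact ⟨y, h1, h2, h3⟩
    obtain ⟨u, hu, hut⟩ := mem_closure_iff_seq_limit.1 hzc
    refine hcl z hz u (fun j => (hu j).2) hut (F z) ?_
    have h1 : Tendsto (fun j => F (u j)) atTop (nhds (F z)) :=
      (hFd z hzW).continuousAt.tendsto.comp hut
    exact h1.congr fun j => hFf _ (hu j)
  have hFD : ∀ z ∈ W, z ∈ D → F z ∈ D' := fun z hz hzD => by
    rw [hFf z ⟨hz, hzD⟩]; exact hfm hzD
  have hnearM : ∀ z ∈ M, ∀ᶠ y in nhds z, r y = 0 → y ∈ M := by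
    intro z hz
    have hzO : z ∈ O := by rw [hMO] at hz; exact hz.2
    filter_upwards [hO.mem_nhds hzO, hΩ.mem_nhds (hMsubΩ z hz)] with y h1 h2 h3
    have : y ∈ frontier D ∩ Ω := by rw [hrbd]; exact ⟨h2, h3⟩
    rw [hMO]; exact ⟨this.1, h1⟩
  have hz0 : ∀ z ∈ M, z ∈ W → ∀ᶠ y in nhds z, r y = 0 → r' (F y) = 0 := by
    intro z hz hzW
    filter_upwards [hnearM z hz, hW.mem_nhds hzW] with y h1 h2 h3
    exact hM'r _ (hFM y (h1 h3) h2)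
  have hzneg : ∀ z ∈ M, z ∈ W → ∀ᶠ y in nhds z, r y < 0 → r' (F y) < 0 := by
    intro z hz hzW
    filter_upwards [hΩ.mem_nhds (hMsubΩ z hz), hW.mem_nhds hzW,
      (hFd z hzW).continuousAt.preimage_mem_nhds (hΩ'.mem_nhds (hM'subΩ _ (hFM z hz hzW)))]
      with y h1 h2 h3 h4
    have h5 : y ∈ D ∩ Ω := by rw [hrD]; exact ⟨h1, h4⟩
    have h6 : F y ∈ D' ∩ Ω' := ⟨hFD y h2 h5.1, h3⟩
    rw [hr'D] at h6
    exact h6.2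
  -- the Jacobian determinant does not vanish on open sets
  have hjf : ∀ z ∈ W ∩ D, jac F z = jac f z := by
    intro z hz
    have h1 : F =ᶠ[nhds z] f := by
      filter_upwards [(hW.inter hD).mem_nhds hz] with y hy
      exact hFf y hy
    unfold jac
    rw [h1.fderiv_eq]
  have hjD : ∀ z ∈ W ∩ D, ¬ ∀ᶠ y in nhds z, jac F y = 0 := by
    intro z hz h
    refine jac_not_zero hD hDconn hD' hf hfm hfp
      (hol_zero_conn hD hDconn.isPreconnected (jac_hol hD hf) hz.2 ?_)
    filter_upwards [h, (hW.inter hD).mem_nhds hz] with y h1 h2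
    rw [← hjf y h2]; exact h1
  have hjM : ∀ z ∈ M, z ∈ W → ¬ ∀ᶠ y in nhds z, jac F y = 0 := by
    intro z hz hzW h
    obtain ⟨y, ⟨h1, h2⟩, h3⟩ := mem_closure_iff_nhds.1 (frontier_subset_closure (hMsub hz)) _
      (inter_mem (eventually_eventually_nhds.2 h) (hW.mem_nhds hzW))
    exact hjD y ⟨h2, h3⟩ h1
  have hjfreq : ∀ z ∈ M, z ∈ W → ∃ᶠ y in nhds z, r y = 0 ∧ jac F y ≠ 0 := by
    intro z hz hzW hn
    refine hjM z hz hzW (hol_vanish (hr z (hMsubΩ z hz)) (hMr z hz) (hrgrad z (hMsubΩ z hz)) ?_ ?_)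
    · filter_upwards [hW.mem_nhds hzW] with y hy
      exact (jac_hol hW hF).differentiableAt (hW.mem_nhds hy)
    · filter_upwards [hn] with y hy h1
      by_contra h2
      exact hy ⟨h1, h2⟩
  have hpM' := hFM p hpM hpW
  have hpO : p ∈ O := by rw [hMO] at hpM; exact hpM.2
  refine ⟨hpM', ?_⟩
  have hiso := isolated_fiber (U := Ω) (hr p (hMsubΩ p hpM)) (hMr p hpM) (hrgrad p (hMsubΩ p hpM))
    (hr' _ (hM'subΩ _ hpM')) (hr'grad _ (hM'subΩ _ hpM'))
    (by filter_upwards [hW.mem_nhds hpW] with y hy using hFd y hy)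
    (hz0 p hpM hpW) (hjM p hpM hpW) (hΩ.mem_nhds (hMsubΩ p hpM))
    (by
      intro φ δ hδ hφ hφr ζ hζ
      have hsc : ∀ ξ ∈ ball (0 : ℂ) 1, (δ : ℂ) * ξ ∈ ball (0 : ℂ) δ := by
        intro ξ hξ
        rw [mem_ball_zero_iff] at hξ ⊢
        rw [norm_mul, Complex.norm_real, Real.norm_eq_abs, abs_of_pos hδ]
        nlinarith
      have hδ' : (δ : ℂ) ≠ 0 := by exact_mod_cast hδ.ne'
      have h := hft (fun ξ => φ ((δ : ℂ) * ξ))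
        (hφ.comp (by fun_prop) hsc)
        (fun ξ hξ => by
          rw [hrbd]; exact hφr _ (hsc ξ hξ))
        (ζ / δ) (by
          rw [mem_ball_zero_iff] at hζ ⊢
          rw [norm_div, Complex.norm_real, Real.norm_eq_abs, abs_of_pos hδ, div_lt_one hδ]
          exact hζ) 0 (by simp)
      simp only [mul_zero] at h
      rwa [mul_div_cancel₀ _ hδ'] at h)
  obtain ⟨ε, hε, hεb⟩ := Metric.nhds_basis_closedBall.mem_iff.1
    (inter_mem hiso (inter_mem (hW.mem_nhds hpW) (inter_mem (hO.mem_nhds hpO) (hO1.mem_nhds hpO1))))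
  have hbM : ∀ z ∈ closedBall p ε, z ∈ frontier D → z ∈ M := fun z hz hzf => by
    rw [hMO]; exact ⟨hzf, (hεb hz).2.2.1⟩
  obtain ⟨δ, hδ, hsurj⟩ := local_surj (D := D) (D' := D') (Ω' := Ω') (F := F) (p := p) (ε := ε)
    (r' := r') hD hD' hε (hMsub hpM) (fun z hz => hFd z (hεb hz).2.1)
    (fun z hz => hFD z (hεb hz).2.1)
    (fun z hz hzf => hM'sub (hFM z (hbM z hz hzf) (hεb hz).2.1))
    (fun z hz hzf he => (hεb hz).1 (hMr z (hbM z hz hzf)) he)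
    hΩ' (hM'subΩ _ hpM') (hr' _ (hM'subΩ _ hpM')).contDiffAt (hr'grad _ (hM'subΩ _ hpM'))
    (hM'r _ hpM') hr'D
    (by
      intro U hU hUD hUb hne
      by_contra hcon
      obtain ⟨y, hy⟩ := hne
      refine hjD y ⟨(hεb (ball_subset_closedBall (hUb hy))).2.1, hUD hy⟩ ?_
      filter_upwards [hU.mem_nhds hy] with x hx
      by_contra h
      exact hcon ⟨x, hx, h⟩)
  refine ⟨ball (F p) δ, isOpen_ball, mem_ball_self hδ, ?_⟩
  rintro q ⟨hqM, hqb⟩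
  obtain ⟨z, hzb, hzf, rfl⟩ := hsurj q (hM'sub hqM) hqb
  have hzM := hbM z (ball_subset_closedBall hzb) hzf
  have hzW := (hεb (ball_subset_closedBall hzb)).2.1
  refine levi_closed (hr' _ (hM'subΩ _ hqM)).contDiffAt (hr'grad _ (hM'subΩ _ hqM)) ?_
  refine (hFd z hzW).continuousAt.tendsto.frequently ?_
  refine ((hjfreq z hzM hzW).and_eventually
    ((hnearM z hzM).and (isOpen_ball.mem_nhds hzb))).mono ?_
  rintro y ⟨⟨hy0, hyJ⟩, hyM, hyb⟩
  have hyM' := hyM hy0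
  have hyB := hεb (ball_subset_closedBall hyb)
  have hFyM := hFM y hyM' hyB.2.1
  exact levi_transfer hW hyB.2.1 (hr y (hMsubΩ y hyM')).contDiffAt hy0 (hrgrad y (hMsubΩ y hyM'))
    (hr' _ (hM'subΩ _ hFyM)).contDiffAt (hr'grad _ (hM'subΩ _ hFyM)) hF hyJ
    (hz0 y hyM' hyB.2.1) (hzneg y hyM' hyB.2.1) (hps y ⟨hyM', hyB.2.2.2⟩)
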